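/- arXiv:2304.01451 — 9 statements merged into one kernel-verified Lean document; each statement's English description precedes it below -/
import Mathlib

section
/- Let 2 ≤ q ≤ m and let c ≥ 1 be a real number. Define the valuation v over [m] by v(∅) = 0, v(S) = 1 whenever 1 ≤ |S| ≤ m−1, and v([m]) = c. Then v is q-partitioning if and only if c ≤ q/(q−1). In particular, the largest value of v([m]) for which v is q-partitioning is q/(q−1). -/
open Finset

/-- A normalized monotone valuation `v : 2^[m] → ℝ≥0`. -/
def IsValuation (m : ℕ) (v : Finset (Fin m) → ℝ) : Prop :=
  v ∅ = 0 ∧ (∀ S T : Finset (Fin m), S ⊆ T → v S ≤ v T) ∧ ∀ S, 0 ≤ v S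

/-- A fractional cover of `[q]`. -/
def IsFractionalCover (q : ℕ) (α : Finset (Fin q) → ℝ) : Prop :=
  (∀ T, 0 ≤ α T) ∧
    ∀ j : Fin q, 1 ≤ ∑ T ∈ Finset.univ.filter (fun T : Finset (Fin q) => j ∈ T), α T

/-- `P` is a partition of `S` into `q` (possibly empty) pairwise disjoint parts. -/
def IsPartitionInto (m q : ℕ) (S : Finset (Fin m)) (P : Fin q → Finset (Fin m)) : Prop :=
  (∀ i j : Fin q, i ≠ j → Disjoint (P i) (P j)) ∧ Finset.univ.biUnion P = S

/-- `v` is `q`-partitioning, i.e. `v ∈ Q(q,[m])`. -/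
def IsQPartitioning (m q : ℕ) (v : Finset (Fin m) → ℝ) : Prop :=
  ∀ S P, IsPartitionInto m q S P → ∀ α, IsFractionalCover q α →
    v S ≤ ∑ T : Finset (Fin q), α T * v (T.biUnion P)

/-- The weighted intersection sizes of a fractional cover with a set `N` sum to at least `#N`. -/
theorem IsFractionalCover.card_le_sum {q : ℕ} {α : Finset (Fin q) → ℝ}
    (hα : IsFractionalCover q α) (N : Finset (Fin q)) :
    (#N : ℝ) ≤ ∑ T : Finset (Fin q), α T * #(T ∩ N) := by
  have h : ∑ T : Finset (Fin q), α T * #(T ∩ N) =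
      ∑ j ∈ N, ∑ T ∈ univ.filter (fun T : Finset (Fin q) => j ∈ T), α T := by
    simp_rw [sum_filter]
    rw [sum_comm]
    refine sum_congr rfl fun T _ => ?_
    rw [← sum_filter, sum_const, nsmul_eq_mul, mul_comm, filter_mem_eq_inter, inter_comm]
  rw [h]
  calc (#N : ℝ) = ∑ j ∈ N, (1 : ℝ) := by simp
    _ ≤ _ := sum_le_sum fun j _ => hα.2 j

/-- The uniform fractional cover of `[q]` by the complements of singletons. -/
noncomputable def eraseCover (q : ℕ) (T : Finset (Fin q)) : ℝ :=
  ∑ i : Fin q, if T = univ.erase i then ((q : ℝ) - 1)⁻¹ else 0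

theorem sum_eraseCover_mul (q : ℕ) (g : Finset (Fin q) → ℝ) :
    ∑ T, eraseCover q T * g T = ∑ i : Fin q, ((q : ℝ) - 1)⁻¹ * g (univ.erase i) := by
  simp_rw [eraseCover, sum_mul]
  rw [sum_comm]
  simp [ite_mul]

theorem isFractionalCover_eraseCover {q : ℕ} (hq : 2 ≤ q) :
    IsFractionalCover q (eraseCover q) := by
  have hq' : (2 : ℝ) ≤ q := by exact_mod_cast hq
  have hpos : 0 < (q : ℝ) - 1 := by linarith
  refine ⟨fun T => sum_nonneg fun i _ => by split_ifs <;> positivity, fun j => ?_⟩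
  have h := sum_eraseCover_mul q fun T => if j ∈ T then 1 else 0
  simp only [mul_ite, mul_one, mul_zero, ← sum_filter] at h
  rw [h, sum_const, nsmul_eq_mul]
  have hf : univ.filter (fun i : Fin q => j ∈ univ.erase i) = univ.erase j := by
    ext i
    simp [eq_comm]
  rw [hf, card_erase_of_mem (mem_univ j), card_univ, Fintype.card_fin,
    Nat.cast_sub (by omega), Nat.cast_one, mul_inv_cancel₀ hpos.ne']

/-- A valuation that is at least `1` on nonempty sets and satisfies `v S * (q - 1) ≤ q` is
`q`-partitioning. -/
theorem isQPartitioning_of_mul_le {m q : ℕ} {v : Finset (Fin m) → ℝ} (h0 : v ∅ = 0)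
    (h1 : ∀ S, S.Nonempty → 1 ≤ v S) (hle : ∀ S, v S * ((q : ℝ) - 1) ≤ q) :
    IsQPartitioning m q v := by
  rintro S P ⟨-, hP⟩ α hα
  have hnn : ∀ T, 0 ≤ v T := fun T => by
    rcases T.eq_empty_or_nonempty with rfl | hT
    · exact h0.ge
    · exact zero_le_one.trans (h1 T hT)
  rcases S.eq_empty_or_nonempty with rfl | hS
  · rw [h0]
    exact sum_nonneg fun T _ => mul_nonneg (hα.1 T) (hnn _)
  set N : Finset (Fin q) := univ.filter fun j => (P j).Nonempty with hN
  have hNpos : 0 < #N := by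
    obtain ⟨x, hx⟩ := hS
    rw [← hP, mem_biUnion] at hx
    obtain ⟨j, -, hj⟩ := hx
    exact card_pos.2 ⟨j, by simpa [hN] using ⟨x, hj⟩⟩
  have hk1 : (1 : ℝ) ≤ #N := by exact_mod_cast hNpos
  have hkq : (#N : ℝ) ≤ q := by
    exact_mod_cast (card_le_univ N).trans_eq (Fintype.card_fin q)
  have hvk : v S * ((#N : ℝ) - 1) ≤ #N := by
    rcases le_total (v S) 1 with h | h
    · nlinarith
    · nlinarith [hle S, mul_nonneg (sub_nonneg.2 h) (sub_nonneg.2 hkq)]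
  have key : ∀ T : Finset (Fin q), v S * #(T ∩ N) ≤ #N * v (T.biUnion P) := fun T => by
    rcases (T ∩ N).eq_empty_or_nonempty with h | ⟨j, hj⟩
    · rw [h]
      simpa using mul_nonneg (Nat.cast_nonneg (#N)) (hnn (T.biUnion P))
    by_cases hT : N ⊆ T
    · have hTS : T.biUnion P = S := by
        rw [← hP]
        refine (biUnion_subset_biUnion_of_subset_left P (subset_univ T)).antisymm fun x hx => ?_
        rw [mem_biUnion] at hx ⊢
        obtain ⟨i, -, hi⟩ := hx
        exact ⟨i, hT (by simpa [hN] using ⟨x, hi⟩), hi⟩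
      rw [hTS, inter_eq_right.2 hT, mul_comm]
    · have hlt : #(T ∩ N) < #N :=
        card_lt_card ⟨inter_subset_right, fun h => hT (h.trans inter_subset_left)⟩
      have hlt' : (#(T ∩ N) : ℝ) ≤ #N - 1 := by
        rw [le_sub_iff_add_le]
        exact_mod_cast hlt
      rw [mem_inter, hN, mem_filter] at hj
      have hne : (T.biUnion P).Nonempty := hj.2.2.mono (subset_biUnion_of_mem P hj.1)
      calc v S * #(T ∩ N) ≤ v S * ((#N : ℝ) - 1) := mul_le_mul_of_nonneg_left hlt' (hnn S)
        _ ≤ #N := hvk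
        _ ≤ #N * v (T.biUnion P) := le_mul_of_one_le_right (by positivity) (h1 _ hne)
  refine le_of_mul_le_mul_left ?_ (zero_lt_one.trans_le hk1)
  calc (#N : ℝ) * v S = v S * #N := mul_comm _ _
    _ ≤ v S * ∑ T : Finset (Fin q), α T * #(T ∩ N) :=
      mul_le_mul_of_nonneg_left (hα.card_le_sum N) (hnn S)
    _ = ∑ T : Finset (Fin q), α T * (v S * #(T ∩ N)) := by
      rw [mul_sum]
      exact sum_congr rfl fun T _ => by ring
    _ ≤ ∑ T : Finset (Fin q), α T * (#N * v (T.biUnion P)) :=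
      sum_le_sum fun T _ => mul_le_mul_of_nonneg_left (key T) (hα.1 T)
    _ = #N * ∑ T : Finset (Fin q), α T * v (T.biUnion P) := by
      rw [mul_sum]
      exact sum_congr rfl fun T _ => by ring

/-- `[m]` can be partitioned into `q ≤ m` nonempty parts. -/
theorem exists_isPartitionInto_univ_nonempty {m q : ℕ} (hq : 0 < q) (hqm : q ≤ m) :
    ∃ P, IsPartitionInto m q univ P ∧ ∀ j, (P j).Nonempty := by
  let f : Fin m → Fin q := fun i => ⟨min i (q - 1), by omega⟩
  refine ⟨fun j => univ.filter fun i => f i = j, ⟨fun i j hij => ?_, ?_⟩, fun j => ?_⟩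
  · rw [disjoint_left]
    intro x hi hj
    simp only [mem_filter, mem_univ, true_and] at hi hj
    exact hij (hi.symm.trans hj)
  · ext x
    simp
  · refine ⟨⟨j, by omega⟩, ?_⟩
    simp only [mem_filter, mem_univ, true_and, f, Fin.ext_iff]
    omega

theorem qPartitioning_threshold (m q : ℕ) (hq : 2 ≤ q) (hqm : q ≤ m)
    (c : ℝ) (hc : 1 ≤ c) (v : Finset (Fin m) → ℝ)
    (hv : ∀ S : Finset (Fin m),
      v S = if S = ∅ then 0 else if S = Finset.univ then c else 1) :
    IsQPartitioning m q v ↔ c ≤ (q : ℝ) / ((q : ℝ) - 1) := by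
  have hq' : (2 : ℝ) ≤ q := by exact_mod_cast hq
  have hpos : 0 < (q : ℝ) - 1 := by linarith
  constructor
  · intro h
    obtain ⟨P, hP, hne⟩ := exists_isPartitionInto_univ_nonempty (by omega) hqm
    have hS := h univ P hP (eraseCover q) (isFractionalCover_eraseCover hq)
    have huniv : (univ : Finset (Fin m)) ≠ ∅ :=
      Nonempty.ne_empty ⟨⟨0, by omega⟩, mem_univ _⟩
    have hone : ∀ i : Fin q, v ((univ.erase i).biUnion P) = 1 := fun i => by
      have : Nontrivial (Fin q) := Fin.nontrivial_iff_two_le.2 hq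
      obtain ⟨j, hj⟩ := exists_ne i
      rw [hv, if_neg, if_neg]
      · intro hu
        obtain ⟨x, hx⟩ := hne i
        have hxu := hu.symm ▸ mem_univ x
        obtain ⟨k, hk, hxk⟩ := mem_biUnion.1 hxu
        exact disjoint_left.1 (hP.1 k i (ne_of_mem_erase hk)) hxk hx
      · exact ((hne j).mono
          (subset_biUnion_of_mem P (mem_erase.2 ⟨hj, mem_univ j⟩))).ne_empty
    rw [sum_eraseCover_mul q fun T => v (T.biUnion P), hv, if_neg huniv, if_pos rfl] at hS
    simpa [hone, div_eq_mul_inv] using hS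
  · intro h
    rw [le_div_iff₀ hpos] at h
    refine isQPartitioning_of_mul_le (by simp [hv]) (fun S hS => ?_) fun S => ?_
    · rw [hv, if_neg hS.ne_empty]
      split_ifs <;> linarith
    · rw [hv]
      split_ifs <;> linarith
end

section
/- For every m and every integer q with 2 ≤ q ≤ m−1, the inclusion Q(q+1,[m]) ⊆ Q(q,[m]) holds and is strict: every (q+1)-partitioning valuation over [m] is q-partitioning, and there exists a normalized monotone valuation over [m] that is q-partitioning but not (q+1)-partitioning. -/
open Finset

/-- Padding a partition with an empty part turns `(q + 1)`-partitioning into `q`-partitioning. -/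
theorem IsQPartitioning.of_succ {m q : ℕ} (hq : 0 < q) {v : Finset (Fin m) → ℝ}
    (hv : IsQPartitioning m (q + 1) v) : IsQPartitioning m q v := by
  intro S P hP α hα
  let ext : Finset (Fin q) → Finset (Fin (q + 1)) :=
    fun T => insert (Fin.last q) (T.map Fin.castSuccEmb)
  have mem_ext : ∀ T j, Fin.castSucc j ∈ ext T ↔ j ∈ T := by
    intro T j
    simp [ext, Fin.castSucc_ne_last]
  have ext_inj : Function.Injective ext := by
    intro T U h
    ext j
    rw [← mem_ext T, ← mem_ext U, h]
  let P' : Fin (q + 1) → Finset (Fin m) := Fin.snoc (α := fun _ => Finset (Fin m)) P ∅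
  have P'_cast : ∀ j, P' (Fin.castSucc j) = P j := fun j => by simp [P']
  have P'_last : P' (Fin.last q) = ∅ := by simp [P']
  let β : Finset (Fin (q + 1)) → ℝ := fun U => ∑ T, if ext T = U then α T else 0
  have sum_β : ∀ f : Finset (Fin (q + 1)) → ℝ, ∑ U, β U * f U = ∑ T, α T * f (ext T) := by
    intro f
    simp only [β, Finset.sum_mul]
    rw [Finset.sum_comm]
    simp [ite_mul]
  have hP' : IsPartitionInto m (q + 1) S P' := by
    constructor
    · intro i j hij
      induction i using Fin.lastCases with
      | last => simp [P'_last]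
      | cast i =>
        induction j using Fin.lastCases with
        | last => simp [P'_last]
        | cast j =>
          rw [P'_cast, P'_cast]
          exact hP.1 i j fun h => hij (by rw [h])
    · rw [← hP.2]
      ext x
      simp [Fin.exists_fin_succ', P'_cast, P'_last]
  have hβ : IsFractionalCover (q + 1) β := by
    refine ⟨fun U => Finset.sum_nonneg fun T _ => ?_, fun j => ?_⟩
    · split_ifs
      exacts [hα.1 T, le_rfl]
    · have h := sum_β fun U => if j ∈ U then 1 else 0
      simp only [mul_ite, mul_one, mul_zero] at h
      rw [Finset.sum_filter, h]
      induction j using Fin.lastCases with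
      | last =>
        refine (hα.2 ⟨0, hq⟩).trans ?_
        simp only [ext, Finset.mem_insert_self, if_true]
        exact Finset.sum_le_sum_of_subset_of_nonneg (Finset.filter_subset _ _)
          fun T _ _ => hα.1 T
      | cast j =>
        simp only [mem_ext]
        rw [← Finset.sum_filter]
        exact hα.2 j
  refine (hv S P' hP' β hβ).trans_eq ?_
  rw [sum_β fun U => v (U.biUnion P')]
  refine Finset.sum_congr rfl fun T _ => ?_
  congr 2
  ext x
  simp [ext, P'_cast, P'_last]

/-- A fractional cover inequality follows from a weighting of the parts in a nonempty set `I`. -/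
theorem IsFractionalCover.le_sum_mul {q : ℕ} {α : Finset (Fin q) → ℝ}
    (hα : IsFractionalCover q α) {I : Finset (Fin q)} (hI : I.Nonempty) {c : ℝ} (hc : 0 ≤ c)
    {w : Finset (Fin q) → ℝ} (h : ∀ T, c * ((I ∩ T).card : ℝ) ≤ I.card * w T) :
    c ≤ ∑ T, α T * w T := by
  have hpos : (0 : ℝ) < I.card := by exact_mod_cast hI.card_pos
  have key : (I.card : ℝ) ≤ ∑ T, α T * ((I ∩ T).card : ℝ) := by
    calc (I.card : ℝ) = ∑ _j ∈ I, (1 : ℝ) := by simp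
      _ ≤ ∑ j ∈ I, ∑ T, if j ∈ T then α T else 0 := by
        refine Finset.sum_le_sum fun j _ => ?_
        rw [← Finset.sum_filter]
        exact hα.2 j
      _ = ∑ T, α T * ((I ∩ T).card : ℝ) := by
        rw [Finset.sum_comm]
        refine Finset.sum_congr rfl fun T _ => ?_
        rw [← Finset.sum_filter, Finset.filter_mem_eq_inter, Finset.sum_const, nsmul_eq_mul,
          mul_comm]
  refine le_of_mul_le_mul_left ?_ hpos
  calc (I.card : ℝ) * c = c * I.card := mul_comm _ _
    _ ≤ c * ∑ T, α T * ((I ∩ T).card : ℝ) := mul_le_mul_of_nonneg_left key hc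
    _ = ∑ T, α T * (c * ((I ∩ T).card : ℝ)) := by
      rw [Finset.mul_sum]
      exact Finset.sum_congr rfl fun T _ => by ring
    _ ≤ ∑ T, α T * (I.card * w T) :=
      Finset.sum_le_sum fun T _ => mul_le_mul_of_nonneg_left (h T) (hα.1 T)
    _ = I.card * ∑ T, α T * w T := by
      rw [Finset.mul_sum]
      exact Finset.sum_congr rfl fun T _ => by ring

/-- The valuation worth `0` on sets missing `A`, `q` on sets containing `A`, and `q - 1` on all
other sets. -/
noncomputable def thresholdValuation {m : ℕ} (q : ℕ) (A S : Finset (Fin m)) : ℝ :=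
  if A ⊆ S then q else if Disjoint A S then 0 else q - 1

section thresholdValuation

variable {m q : ℕ} {A : Finset (Fin m)}

theorem thresholdValuation_of_subset {S : Finset (Fin m)} (h : A ⊆ S) :
    thresholdValuation q A S = q := if_pos h

theorem thresholdValuation_of_not_subset {S : Finset (Fin m)} (h : ¬ A ⊆ S)
    (h' : ¬ Disjoint A S) : thresholdValuation q A S = q - 1 := by
  simp [thresholdValuation, h, h']

theorem thresholdValuation_of_disjoint (hA : A.Nonempty) {S : Finset (Fin m)}
    (h : Disjoint A S) : thresholdValuation q A S = 0 := by
  have : ¬ A ⊆ S := fun h' => hA.ne_empty (Finset.disjoint_self_iff_empty A |>.1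
    (h.mono_right h'))
  simp [thresholdValuation, h, this]

theorem thresholdValuation_nonneg (hq : 1 ≤ q) (S : Finset (Fin m)) :
    0 ≤ thresholdValuation q A S := by
  have : (1 : ℝ) ≤ q := by exact_mod_cast hq
  unfold thresholdValuation
  split_ifs <;> linarith

theorem isValuation_thresholdValuation (hq : 1 ≤ q) (hA : A.Nonempty) :
    IsValuation m (thresholdValuation q A) := by
  refine ⟨thresholdValuation_of_disjoint hA (Finset.disjoint_empty_right A), ?_,
    thresholdValuation_nonneg hq⟩
  intro S T hST
  have : (1 : ℝ) ≤ q := by exact_mod_cast hq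
  by_cases hS : Disjoint A S
  · rw [thresholdValuation_of_disjoint hA hS]
    exact thresholdValuation_nonneg hq T
  have hT : ¬ Disjoint A T := fun h => hS (h.mono_right hST)
  by_cases hAS : A ⊆ S
  · rw [thresholdValuation_of_subset hAS, thresholdValuation_of_subset (hAS.trans hST)]
  · rw [thresholdValuation_of_not_subset hAS hS]
    unfold thresholdValuation
    split_ifs <;> linarith

theorem isQPartitioning_thresholdValuation (hq : 1 ≤ q) (hA : A.Nonempty) :
    IsQPartitioning m q (thresholdValuation q A) := by
  intro S P hP α hα
  have hq' : (1 : ℝ) ≤ q := by exact_mod_cast hq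
  have hval := isValuation_thresholdValuation hq hA
  by_cases hS : Disjoint A S
  · rw [thresholdValuation_of_disjoint hA hS]
    exact Finset.sum_nonneg fun T _ => mul_nonneg (hα.1 T) (hval.2.2 _)
  obtain ⟨a, haA, haS⟩ := Finset.not_disjoint_iff.1 hS
  obtain ⟨i, -, hi⟩ := Finset.mem_biUnion.1 (hP.2 ▸ haS)
  by_cases hAS : A ⊆ S
  · rw [thresholdValuation_of_subset hAS]
    set I : Finset (Fin q) := Finset.univ.filter fun j => ¬ Disjoint A (P j) with hI
    have hIne : I.Nonempty :=
      ⟨i, by simpa [hI] using Finset.not_disjoint_iff.2 ⟨a, haA, hi⟩⟩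
    refine hα.le_sum_mul hIne (by linarith) fun T => ?_
    have hIq : (I.card : ℝ) ≤ q := by
      exact_mod_cast (Finset.card_le_univ I).trans_eq (Fintype.card_fin q)
    by_cases hT : A ⊆ T.biUnion P
    · rw [thresholdValuation_of_subset hT, mul_comm]
      have : ((I ∩ T).card : ℝ) ≤ I.card := by
        exact_mod_cast Finset.card_le_card Finset.inter_subset_left
      gcongr
    by_cases hd : Disjoint A (T.biUnion P)
    · have : I ∩ T = ∅ := by
        rw [Finset.disjoint_biUnion_right] at hd
        refine Finset.eq_empty_of_forall_notMem fun j hj => ?_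
        rw [Finset.mem_inter, hI, Finset.mem_filter] at hj
        exact hj.1.2 (hd j hj.2)
      rw [thresholdValuation_of_disjoint hA hd, this]
      simp
    · rw [thresholdValuation_of_not_subset hT hd]
      have hlt : I ∩ T ⊂ I := by
        refine Finset.inter_subset_left.ssubset_of_ne fun h => hT fun x hx => ?_
        obtain ⟨j, -, hj⟩ := Finset.mem_biUnion.1 (hP.2 ▸ hAS hx)
        have hjI : j ∈ I := by simpa [hI] using Finset.not_disjoint_iff.2 ⟨x, hx, hj⟩
        exact Finset.mem_biUnion.2 ⟨j, Finset.inter_eq_left.1 h hjI, hj⟩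
      have : ((I ∩ T).card : ℝ) + 1 ≤ I.card := by exact_mod_cast Finset.card_lt_card hlt
      nlinarith
  · refine hα.le_sum_mul (Finset.singleton_nonempty i) (hval.2.2 S) fun T => ?_
    by_cases hiT : i ∈ T
    · have hd : ¬ Disjoint A (T.biUnion P) :=
        Finset.not_disjoint_iff.2 ⟨a, haA, Finset.mem_biUnion.2 ⟨i, hiT, hi⟩⟩
      have hsub : ¬ A ⊆ T.biUnion P := fun h => hAS <| h.trans <|
        (Finset.biUnion_subset_biUnion_of_subset_left P (Finset.subset_univ T)).trans hP.2.subset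
      rw [thresholdValuation_of_not_subset hAS hS, thresholdValuation_of_not_subset hsub hd,
        Finset.singleton_inter_of_mem hiT]
      simp
    · rw [Finset.singleton_inter_of_notMem hiT]
      simpa using hval.2.2 _

end thresholdValuation

/-- Covering `[q + 1]` uniformly by its subsets of size `q`. -/
theorem isFractionalCover_card_eq {q : ℕ} (hq : 1 ≤ q) :
    IsFractionalCover (q + 1) fun T => if T.card = q then (q : ℝ)⁻¹ else 0 := by
  have hq' : (0 : ℝ) < q := by exact_mod_cast hq
  refine ⟨fun T => by dsimp only; split_ifs <;> positivity, fun j => ?_⟩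
  have hinj : Function.Injective fun k : Fin (q + 1) => ({k} : Finset (Fin (q + 1)))ᶜ :=
    compl_injective.comp Finset.singleton_injective
  calc (1 : ℝ) = ∑ _k ∈ Finset.univ.erase j, (q : ℝ)⁻¹ := by
        rw [Finset.sum_const, Finset.card_erase_of_mem (Finset.mem_univ j), Finset.card_univ,
          Fintype.card_fin, Nat.add_sub_cancel, nsmul_eq_mul, mul_inv_cancel₀ hq'.ne']
    _ = ∑ T ∈ (Finset.univ.erase j).image fun k : Fin (q + 1) => ({k} : Finset (Fin (q + 1)))ᶜ,
          if T.card = q then (q : ℝ)⁻¹ else 0 := by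
        rw [Finset.sum_image hinj.injOn]
        exact Finset.sum_congr rfl fun k _ => by simp [Finset.card_compl]
    _ ≤ _ := by
        refine Finset.sum_le_sum_of_subset_of_nonneg (fun T hT => ?_) fun T _ _ => ?_
        · obtain ⟨k, hk, rfl⟩ := Finset.mem_image.1 hT
          simpa using (Finset.ne_of_mem_erase hk).symm
        · split_ifs <;> positivity

theorem not_isQPartitioning_thresholdValuation {m q : ℕ} (hq : 1 ≤ q)
    (e : Fin (q + 1) ↪ Fin m) :
    ¬ IsQPartitioning m (q + 1) (thresholdValuation q (Finset.univ.map e)) := by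
  intro h
  have hq' : (1 : ℝ) ≤ q := by exact_mod_cast hq
  have hP : IsPartitionInto m (q + 1) (Finset.univ.map e) fun i => {e i} := by
    refine ⟨fun i j hij => by simpa using hij, ?_⟩
    ext x
    simp [eq_comm]
  have h := h _ _ hP _ (isFractionalCover_card_eq hq)
  rw [thresholdValuation_of_subset subset_rfl] at h
  have hle : ∀ T : Finset (Fin (q + 1)),
      (if T.card = q then (q : ℝ)⁻¹ else 0) *
          thresholdValuation q (Finset.univ.map e) (T.biUnion fun i => {e i}) ≤
        if T.card = q then (q : ℝ)⁻¹ * (q - 1) else 0 := by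
    intro T
    by_cases hT : T.card = q
    · have hsub : ¬ Finset.univ.map e ⊆ T.biUnion fun i => {e i} := by
        intro hs
        have huniv : T = Finset.univ := by
          refine Finset.eq_univ_of_forall fun j => ?_
          simpa using hs (Finset.mem_map_of_mem e (Finset.mem_univ j))
        rw [huniv, Finset.card_univ, Fintype.card_fin] at hT
        omega
      simp only [hT, if_true]
      refine mul_le_mul_of_nonneg_left ?_ (by positivity)
      unfold thresholdValuation
      rw [if_neg hsub]
      split_ifs <;> linarith
    · simp [hT]
  have hcard : (Finset.univ.filter fun T : Finset (Fin (q + 1)) => T.card = q).card = q + 1 := by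
    rw [Finset.univ_filter_card_eq, Finset.card_powersetCard, Finset.card_univ, Fintype.card_fin,
      Nat.choose_succ_self_right]
  have h := h.trans (Finset.sum_le_sum fun T _ => hle T)
  rw [← Finset.sum_filter, Finset.sum_const, hcard, nsmul_eq_mul] at h
  have hmul : (q : ℝ) * q ≤ q * (((q + 1 : ℕ) : ℝ) * ((q : ℝ)⁻¹ * (q - 1))) :=
    mul_le_mul_of_nonneg_left h (by linarith)
  have heq : (q : ℝ) * (((q + 1 : ℕ) : ℝ) * ((q : ℝ)⁻¹ * (q - 1))) = q * q - 1 := by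
    have : (q : ℝ) ≠ 0 := by positivity
    push_cast
    field_simp
    ring
  linarith

theorem qPartitioning_chain_strict (m q : ℕ) (hq : 2 ≤ q) (hqm : q + 1 ≤ m) :
    (∀ v : Finset (Fin m) → ℝ, IsValuation m v →
      IsQPartitioning m (q + 1) v → IsQPartitioning m q v) ∧
    ∃ v : Finset (Fin m) → ℝ, IsValuation m v ∧
      IsQPartitioning m q v ∧ ¬ IsQPartitioning m (q + 1) v := by
  have hq1 : 1 ≤ q := by omega
  have hA : (Finset.univ.map (Fin.castLEEmb hqm)).Nonempty :=
    Finset.univ_nonempty.map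
  exact ⟨fun v _ hv => hv.of_succ hq1, thresholdValuation q (Finset.univ.map (Fin.castLEEmb hqm)),
    isValuation_thresholdValuation hq1 hA, isQPartitioning_thresholdValuation hq1 hA,
    not_isQPartitioning_thresholdValuation hq1 _⟩
end

section
/- Let c : 2^[m] → ℝ≥0 be a normalized monotone cost function and let 2 ≤ q ≤ m. The following are equivalent: (i) for every S ⊆ [m] and every partition of S into q (possibly empty) pairwise disjoint parts S_1,…,S_q, there exists a non-negative vector (p_1,…,p_q) with ∑_{i∈T} p_i ≤ c(⋃_{i∈T}S_i) for all T ⊆ [q] and ∑_{i∈[q]} p_i = c(S) (i.e., the citycore of the game is non-empty); (ii) c is q-partitioning. -/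
open Finset

/-- Double counting: weighting each coordinate by the total weight of the sets containing it. -/
theorem sum_mul_sum_mem_eq {ι : Type*} [Fintype ι] [DecidableEq ι]
    (p : ι → ℝ) (α : Finset ι → ℝ) :
    ∑ T : Finset ι, α T * ∑ i ∈ T, p i =
      ∑ i, p i * ∑ T ∈ Finset.univ.filter (fun T : Finset ι => i ∈ T), α T := by
  have h (T : Finset ι) : ∑ i ∈ T, p i = ∑ i, if i ∈ T then p i else 0 := by
    rw [← Finset.sum_filter, Finset.filter_mem_eq_inter, Finset.univ_inter]
  simp_rw [h, Finset.mul_sum, Finset.sum_filter]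
  rw [Finset.sum_comm]
  refine Finset.sum_congr rfl fun i _ => Finset.sum_congr rfl fun T _ => ?_
  split_ifs <;> ring

/-- If no point of the simplex of total mass `C` is bounded on every set `T` by `g T`, then some
nonnegative weights on sets give every point of the simplex a larger weighted sum than `g`. -/
theorem exists_weights_of_forall_simplex_violates {ι : Type*} [Fintype ι] [DecidableEq ι]
    (C : ℝ) (g : Finset ι → ℝ)
    (h : ∀ w ∈ stdSimplex ℝ ι, ∃ T : Finset ι, g T < ∑ i ∈ T, C * w i) :
    ∃ α : Finset ι → ℝ, (∀ T, 0 ≤ α T) ∧ ∀ w ∈ stdSimplex ℝ ι,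
      ∑ T, α T * g T < ∑ T : Finset ι, α T * ∑ i ∈ T, C * w i := by
  let L : (ι → ℝ) →ₗ[ℝ] (Finset ι → ℝ) :=
    LinearMap.pi fun T => ∑ i ∈ T, C • LinearMap.proj i
  have hL (w : ι → ℝ) (T : Finset ι) : L w T = ∑ i ∈ T, C * w i := by simp [L]
  have hdisj : Disjoint (Set.Iic g) (L '' stdSimplex ℝ ι) := by
    rw [Set.disjoint_right]
    rintro _ ⟨w, hw, rfl⟩ hle
    obtain ⟨T, hT⟩ := h w hw
    exact absurd (hle T) (by rw [hL]; exact not_le.2 hT)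
  obtain ⟨f, u, v, hfu, huv, hvf⟩ := geometric_hahn_banach_closed_compact (convex_Iic g)
    isClosed_Iic ((convex_stdSimplex ℝ ι).linear_image L)
    ((isCompact_stdSimplex ℝ ι).image L.continuous_of_finiteDimensional) hdisj
  have hf (x : Finset ι → ℝ) : f x = ∑ T, f (Pi.single T 1) * x T := by
    have := LinearMap.pi_apply_eq_sum_univ f.toLinearMap x
    simp only [ContinuousLinearMap.coe_coe, smul_eq_mul] at this
    rw [this]
    refine Finset.sum_congr rfl fun T _ => ?_
    rw [mul_comm]
    congr 2
    ext U
    simp [Pi.single_apply, eq_comm]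
  refine ⟨fun T => f (Pi.single T 1), fun T => ?_, fun w hw => ?_⟩
  · by_contra! hneg
    have hg := hfu g Set.self_mem_Iic
    set a := f (Pi.single T 1) with ha
    have ht : 0 ≤ (u - f g) / -a := div_nonneg (by linarith) (by linarith)
    have hmem : g - ((u - f g) / -a) • Pi.single T (1 : ℝ) ∈ Set.Iic g :=
      sub_le_self g (smul_nonneg ht (Pi.single_nonneg.2 zero_le_one))
    have hlt := hfu _ hmem
    rw [map_sub, map_smul, smul_eq_mul, ← ha] at hlt
    have : (u - f g) / -a * a = -(u - f g) := by
      have := hneg.ne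
      field_simp
    linarith
  · have hlt := ((hfu g Set.self_mem_Iic).trans huv).trans (hvf _ ⟨w, hw, rfl⟩)
    rw [hf g, hf (L w)] at hlt
    simpa only [hL] using hlt

/-- A game whose value `C` is a lower bound for every fractional cover has a nonempty core. -/
theorem exists_core_of_le_fractionalCover {q : ℕ} [NeZero q] {C : ℝ} {g : Finset (Fin q) → ℝ}
    (hC : 0 ≤ C) (hg : ∀ T, 0 ≤ g T)
    (h : ∀ α, IsFractionalCover q α → C ≤ ∑ T, α T * g T) :
    ∃ p : Fin q → ℝ, (∀ i, 0 ≤ p i) ∧ (∀ T, ∑ i ∈ T, p i ≤ g T) ∧ ∑ i, p i = C := by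
  by_contra hne
  obtain ⟨α, hα, hlt⟩ := exists_weights_of_forall_simplex_violates C g fun w hw => by
    by_contra! hle
    exact hne ⟨fun i => C * w i, fun i => mul_nonneg hC (hw.1 i), hle, by
      rw [← Finset.mul_sum, hw.2, mul_one]⟩
  set β : Fin q → ℝ := fun i => ∑ T ∈ Finset.univ.filter (fun T : Finset (Fin q) => i ∈ T), α T
  obtain ⟨j, -, hj⟩ := Finset.exists_min_image Finset.univ β Finset.univ_nonempty
  have hjlt := hlt _ (single_mem_stdSimplex ℝ j)
  rw [sum_mul_sum_mem_eq] at hjlt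
  simp only [Pi.single_apply, mul_ite, mul_one, mul_zero, ite_mul, zero_mul,
    Finset.sum_ite_eq', Finset.mem_univ, if_true] at hjlt
  change _ < C * β j at hjlt
  have hnonneg : 0 ≤ ∑ T, α T * g T :=
    Finset.sum_nonneg fun T _ => mul_nonneg (hα T) (hg T)
  have hpos : 0 < β j := pos_of_mul_pos_right (hnonneg.trans_lt hjlt) hC
  have hcover : IsFractionalCover q fun T => α T / β j := by
    refine ⟨fun T => div_nonneg (hα T) hpos.le, fun i => ?_⟩
    rw [← Finset.sum_div, one_le_div hpos]
    exact hj i (Finset.mem_univ i)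
  have hle := h _ hcover
  simp_rw [div_mul_eq_mul_div] at hle
  rw [← Finset.sum_div, le_div_iff₀ hpos] at hle
  exact absurd hle (not_le.2 hjlt)

theorem citycore_nonempty_iff_qPartitioning (m q : ℕ) (hq : 2 ≤ q) (hqm : q ≤ m)
    (c : Finset (Fin m) → ℝ) (hc : IsValuation m c) :
    (∀ S P, IsPartitionInto m q S P →
      ∃ p : Fin q → ℝ, (∀ i, 0 ≤ p i) ∧
        (∀ T : Finset (Fin q), ∑ i ∈ T, p i ≤ c (T.biUnion P)) ∧
        ∑ i : Fin q, p i = c S) ↔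
    IsQPartitioning m q c := by
  constructor
  · intro h S P hP α hα
    obtain ⟨p, hp, hle, hsum⟩ := h S P hP
    calc c S = ∑ i, p i := hsum.symm
      _ ≤ ∑ i, p i * ∑ T ∈ Finset.univ.filter (fun T : Finset (Fin q) => i ∈ T), α T :=
        Finset.sum_le_sum fun i _ => le_mul_of_one_le_right (hp i) (hα.2 i)
      _ = ∑ T : Finset (Fin q), α T * ∑ i ∈ T, p i := (sum_mul_sum_mem_eq p α).symm
      _ ≤ ∑ T : Finset (Fin q), α T * c (T.biUnion P) :=
        Finset.sum_le_sum fun T _ => mul_le_mul_of_nonneg_left (hle T) (hα.1 T)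
  · intro h S P hP
    have : NeZero q := ⟨by omega⟩
    exact exists_core_of_le_fractionalCover (hc.2.2 S) (fun T => hc.2.2 _) (h S P hP)
end

section
/- Let c : 2^[m] → ℝ≥0 be a normalized monotone cost function, let 2 ≤ q ≤ m, and let 0 < γ ≤ 1. The following are equivalent: (i) for every S ⊆ [m] and every partition of S into q (possibly empty) pairwise disjoint parts S_1,…,S_q, there exists a non-negative vector (p_1,…,p_q) with ∑_{i∈T} p_i ≤ c(⋃_{i∈T}S_i) for all T ⊆ [q] and γ·c(S) ≤ ∑_{i∈[q]} p_i ≤ c(S) (i.e., the γ-citycore is non-empty); (ii) c is γ-close to q-partitioning. -/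
open Finset

/-- Theorem of the alternative: a compact convex set missing the nonpositive orthant has a
nonnegative weight vector that is strictly positive on it. -/
theorem exists_nonneg_weights_pos_of_disjoint_Iic {ι : Type*} [Fintype ι] [DecidableEq ι]
    {C : Set (ι → ℝ)} (hC : Convex ℝ C) (hC' : IsCompact C) (h : Disjoint (Set.Iic 0) C) :
    ∃ w : ι → ℝ, (∀ i, 0 ≤ w i) ∧ ∀ y ∈ C, 0 < ∑ i, w i * y i := by
  obtain ⟨φ, u, v, hu, huv, hv⟩ :=
    geometric_hahn_banach_closed_compact (convex_Iic (0 : ι → ℝ)) isClosed_Iic hC hC' h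
  have hu0 : 0 < u := by simpa using hu 0 (Set.mem_Iic.2 le_rfl)
  refine ⟨fun i => φ (Pi.single i 1), fun i => ?_, fun y hy => ?_⟩
  · by_contra! hneg
    have hmem : (u / φ (Pi.single i 1)) • (Pi.single i 1 : ι → ℝ) ∈ Set.Iic 0 :=
      Set.mem_Iic.2 <| smul_nonpos_of_nonpos_of_nonneg (div_nonpos_of_nonneg_of_nonpos hu0.le hneg.le)
        (Pi.single_nonneg.2 zero_le_one)
    have := hu _ hmem
    rw [map_smul, smul_eq_mul, div_mul_cancel₀ _ hneg.ne] at this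
    exact lt_irrefl _ this
  · have hφ : φ y = ∑ i, φ (Pi.single i 1) * y i := by
      conv_lhs => rw [pi_eq_sum_univ' y]
      simp [map_sum, mul_comm, Pi.single]
    rw [← hφ]
    linarith [hv y hy]

theorem sum_mul_sum_eq_sum_mul_sum_filter {ι : Type*} [Fintype ι] [DecidableEq ι]
    (α : Finset ι → ℝ) (p : ι → ℝ) :
    ∑ T, α T * ∑ j ∈ T, p j = ∑ j, p j * ∑ T with j ∈ T, α T := by
  simp only [Finset.mul_sum, Finset.sum_filter]
  rw [Finset.sum_comm]
  refine Finset.sum_congr rfl fun T _ => ?_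
  simp [mul_comm, Finset.sum_ite_mem]

/-- A form of the Bondareva–Shapley theorem: if every fractional cover costs at least `r`,
then a total of at least `r` can be shared so that no coalition is overcharged. -/
theorem exists_core_vector_of_forall_fractionalCover {q : ℕ} (f : Finset (Fin q) → ℝ)
    (hf : ∀ T, 0 ≤ f T) (r : ℝ)
    (h : ∀ α, IsFractionalCover q α → r ≤ ∑ T, α T * f T) :
    ∃ p : Fin q → ℝ, (∀ i, 0 ≤ p i) ∧ (∀ T, ∑ i ∈ T, p i ≤ f T) ∧ r ≤ ∑ i, p i := by
  by_contra! hcon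
  let F : (Fin q → ℝ) → Option (Finset (Fin q)) → ℝ := fun p o =>
    o.elim (r - ∑ i, p i) fun T => ∑ i ∈ T, p i - f T
  have hFcont : Continuous F := continuous_pi fun o => by
    cases o <;> simp only [F, Option.elim] <;> fun_prop
  have hFconv : Convex ℝ (F '' Set.Icc 0 fun j => f {j}) := by
    rintro _ ⟨x, hx, rfl⟩ _ ⟨y, hy, rfl⟩ a b ha hb hab
    refine ⟨a • x + b • y, convex_Icc _ _ hx hy ha hb hab, funext fun o => ?_⟩
    obtain rfl : b = 1 - a := by linarith
    cases o <;> simp only [F, Option.elim, Pi.add_apply, Pi.smul_apply, smul_eq_mul,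
      Finset.sum_add_distrib, ← Finset.mul_sum] <;> ring
  have hdisj : Disjoint (Set.Iic 0) (F '' Set.Icc 0 fun j => f {j}) := by
    rw [Set.disjoint_left]
    rintro _ hle ⟨p, hp, rfl⟩
    exact (hcon p hp.1 fun T => sub_nonpos.1 (hle (some T))).not_ge (sub_nonpos.1 (hle none))
  obtain ⟨w, hw, hpos⟩ := exists_nonneg_weights_pos_of_disjoint_Iic hFconv
    (isCompact_Icc.image hFcont) hdisj
  set β := w none
  set s : Fin q → ℝ := fun j => ∑ T with j ∈ T, w (some T)
  -- Singletons make up the deficit of the separating weights.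
  set d : Fin q → ℝ := fun j => max 0 (β - s j)
  set p : Fin q → ℝ := fun j => if s j < β then f {j} else 0
  have hpd : ∀ j, p j * (s j - β) = -(d j * f {j}) := fun j => by
    by_cases hj : s j < β
    · simp only [p, d, if_pos hj, max_eq_right (sub_nonneg.2 hj.le)]; ring
    · simp [p, d, if_neg hj, max_eq_left (sub_nonpos.2 (not_lt.1 hj))]
  have hp : p ∈ Set.Icc 0 fun j => f {j} := by
    constructor <;> intro j <;> by_cases hj : s j < β <;> simp [p, hj, hf]
  have key : ∑ T, w (some T) * f T + ∑ j, d j * f {j} < β * r := by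
    have h1 := hpos _ ⟨p, hp, rfl⟩
    rw [Fintype.sum_option] at h1
    simp only [F, Option.elim, mul_sub, Finset.sum_sub_distrib] at h1
    rw [sum_mul_sum_eq_sum_mul_sum_filter] at h1
    have h2 : ∑ j, p j * s j - β * ∑ j, p j = -∑ j, d j * f {j} := by
      rw [Finset.mul_sum, ← Finset.sum_sub_distrib, ← Finset.sum_neg_distrib]
      exact Finset.sum_congr rfl fun j _ => by rw [← hpd j]; ring
    linarith
  have hd : ∀ j, 0 ≤ d j := fun j => le_max_left _ _
  have hβ : 0 < β := by
    refine (hw none).lt_of_ne fun h0 => ?_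
    have h1 : 0 ≤ ∑ T, w (some T) * f T := Finset.sum_nonneg fun T _ => mul_nonneg (hw _) (hf T)
    have h2 : 0 ≤ ∑ j, d j * f {j} := Finset.sum_nonneg fun j _ => mul_nonneg (hd j) (hf _)
    have h3 : β * r = 0 := by rw [show β = 0 from h0.symm, zero_mul]
    linarith
  set α : Finset (Fin q) → ℝ := fun T =>
    (w (some T) + ∑ j : Fin q, if T = {j} then d j else 0) / β
  have hnonneg : ∀ T : Finset (Fin q), 0 ≤ ∑ j : Fin q, if T = {j} then d j else 0 := fun T =>
    Finset.sum_nonneg fun j _ => by split_ifs <;> simp [hd]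
  have hα : IsFractionalCover q α := by
    refine ⟨fun T => div_nonneg (add_nonneg (hw _) (hnonneg T)) hβ.le, fun j => ?_⟩
    rw [← Finset.sum_div, one_le_div hβ, Finset.sum_add_distrib]
    have h1 : d j ≤ ∑ T : Finset (Fin q) with j ∈ T, ∑ i : Fin q, if T = {i} then d i else 0 := by
      refine le_trans ?_ (Finset.single_le_sum (fun T _ => hnonneg T)
        (Finset.mem_filter.2 ⟨Finset.mem_univ _, Finset.mem_singleton_self j⟩))
      simp
    have h2 : β - s j ≤ d j := le_max_right _ _
    change β ≤ s j + _
    linarith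
  have hcost : β * ∑ T, α T * f T = ∑ T, w (some T) * f T + ∑ j, d j * f {j} := by
    have h1 : ∑ j, d j * f {j} = ∑ T, (∑ j : Fin q, if T = {j} then d j else 0) * f T := by
      simp only [Finset.sum_mul, ite_mul, zero_mul]
      rw [Finset.sum_comm]
      simp
    rw [h1, ← Finset.sum_add_distrib, Finset.mul_sum]
    refine Finset.sum_congr rfl fun T _ => ?_
    simp only [α]
    field_simp
  have := mul_le_mul_of_nonneg_left (h α hα) hβ.le
  linarith

theorem gammaCitycore_nonempty_iff_gammaClose (m q : ℕ) (hq : 2 ≤ q) (hqm : q ≤ m)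
    (γ : ℝ) (hγ0 : 0 < γ) (hγ1 : γ ≤ 1)
    (c : Finset (Fin m) → ℝ) (hc : IsValuation m c) :
    (∀ S P, IsPartitionInto m q S P →
      ∃ p : Fin q → ℝ, (∀ i, 0 ≤ p i) ∧
        (∀ T : Finset (Fin q), ∑ i ∈ T, p i ≤ c (T.biUnion P)) ∧
        γ * c S ≤ ∑ i : Fin q, p i ∧ ∑ i : Fin q, p i ≤ c S) ↔
    (∀ S P, IsPartitionInto m q S P → ∀ α, IsFractionalCover q α →
      γ * c S ≤ ∑ T : Finset (Fin q), α T * c (T.biUnion P)) := by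
  constructor
  · intro h S P hP α hα
    obtain ⟨p, hp, hpT, hγ, -⟩ := h S P hP
    calc γ * c S ≤ ∑ i, p i := hγ
      _ ≤ ∑ j, p j * ∑ T with j ∈ T, α T :=
        Finset.sum_le_sum fun j _ => le_mul_of_one_le_right (hp j) (hα.2 j)
      _ = ∑ T, α T * ∑ j ∈ T, p j := (sum_mul_sum_eq_sum_mul_sum_filter α p).symm
      _ ≤ ∑ T, α T * c (T.biUnion P) :=
        Finset.sum_le_sum fun T _ => mul_le_mul_of_nonneg_left (hpT T) (hα.1 T)
  · intro h S P hP
    obtain ⟨p, hp, hpT, hγ⟩ := exists_core_vector_of_forall_fractionalCover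
      (fun T => c (T.biUnion P)) (fun T => hc.2.2 _) (γ * c S) (h S P hP)
    exact ⟨p, hp, hpT, hγ, hP.2 ▸ hpT Finset.univ⟩
end

section
/- Let v : 2^[m] → ℝ≥0 be a normalized monotone valuation and 2 ≤ q ≤ m. Then v is q-partitioning if and only if v satisfies the dual q-partitioning property: for every S ⊆ [m] and every partition of S into q pairwise disjoint (possibly empty) parts S_1,…,S_q, there exist non-negative reals p_1,…,p_q with ∑_{j∈T} p_j ≤ v(⋃_{j∈T} S_j) for all T ⊆ [q] and ∑_{j∈[q]} p_j ≥ v(S). -/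
open Finset

/-- A compact convex set missing the nonpositive orthant is strictly positive under some
nonnegative weighting of the coordinates. -/
theorem exists_nonneg_weights_pos {ι : Type*} [Fintype ι] {C : Set (ι → ℝ)}
    (hC : IsCompact C) (hconv : Convex ℝ C) (h : ∀ x ∈ C, ∃ i, 0 < x i) :
    ∃ c : ι → ℝ, (∀ i, 0 ≤ c i) ∧ ∀ x ∈ C, 0 < ∑ i, c i * x i := by
  classical
  have hdisj : Disjoint C (Set.Iic 0) := by
    rw [Set.disjoint_left]
    intro x hx hx0
    obtain ⟨i, hi⟩ := h x hx
    exact absurd (hx0 i) (not_le.mpr hi)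
  obtain ⟨f, u, u', hfu, huu', hfu'⟩ :=
    geometric_hahn_banach_compact_closed hconv hC (convex_Iic 0) isClosed_Iic hdisj
  have hu' : u' < 0 := by simpa using hfu' 0 (Set.mem_Iic.mpr le_rfl)
  have hf : ∀ x : ι → ℝ, f x = ∑ i, x i * f (Pi.single i 1) := fun x => by
    conv_lhs => rw [pi_eq_sum_univ' x]
    simp [map_sum]
  refine ⟨fun i => -f (Pi.single i 1), fun i => ?_, fun x hx => ?_⟩
  · by_contra! hi
    have hi : 0 < f (Pi.single i 1) := by linarith
    have hmem : (u' / f (Pi.single i 1)) • (Pi.single i 1 : ι → ℝ) ∈ Set.Iic (0 : ι → ℝ) := by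
      refine Set.mem_Iic.mpr (smul_nonpos_of_nonpos_of_nonneg ?_ ?_)
      · exact (div_neg_of_neg_of_pos hu' hi).le
      · exact Pi.single_nonneg.mpr zero_le_one
    have := hfu' _ hmem
    rw [map_smul, smul_eq_mul, div_mul_cancel₀ _ hi.ne'] at this
    exact lt_irrefl _ this
  · have := hfu x hx
    rw [hf] at this
    have hneg : ∑ i, -f (Pi.single i 1) * x i = -∑ i, x i * f (Pi.single i 1) := by
      rw [← Finset.sum_neg_distrib]
      exact Finset.sum_congr rfl fun i _ => by ring
    rw [hneg]
    linarith

/-- Exchange of summation between sets and their elements. -/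
theorem sum_mul_sum_mem {κ : Type*} [Fintype κ] [DecidableEq κ] (α : Finset κ → ℝ) (p : κ → ℝ) :
    ∑ T, α T * ∑ j ∈ T, p j = ∑ j, (∑ T with j ∈ T, α T) * p j := by
  simp_rw [Finset.mul_sum, Finset.sum_mul]
  exact Finset.sum_comm' (by simp)

/-- Strong duality for the fractional cover linear program. -/
theorem exists_prices_of_le_fractionalCover {q : ℕ} (w : Finset (Fin q) → ℝ) (hw : ∀ T, 0 ≤ w T)
    (b : ℝ) (h : ∀ α, IsFractionalCover q α → b ≤ ∑ T, α T * w T) :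
    ∃ p : Fin q → ℝ, (∀ j, 0 ≤ p j) ∧ (∀ T : Finset (Fin q), ∑ j ∈ T, p j ≤ w T) ∧
      b ≤ ∑ j, p j := by
  by_contra! hno
  let g : (Fin q → ℝ) → Option (Finset (Fin q)) → ℝ :=
    fun p o => o.elim (b - ∑ j, p j) fun T => ∑ j ∈ T, p j - w T
  let B : Set (Fin q → ℝ) := Set.Icc 0 fun j => w {j}
  have hg : Continuous g := by
    refine continuous_pi fun o => ?_
    cases o <;> simp only [g, Option.elim] <;> fun_prop
  have hconv : Convex ℝ (g '' B) := by
    rintro _ ⟨x, hx, rfl⟩ _ ⟨y, hy, rfl⟩ s t hs ht hst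
    refine ⟨s • x + t • y, convex_Icc _ _ hx hy hs ht hst, ?_⟩
    obtain rfl : t = 1 - s := by linarith
    funext o
    cases o <;> simp [g, Finset.sum_add_distrib, ← Finset.mul_sum] <;> ring
  obtain ⟨c, hc, hpos⟩ := exists_nonneg_weights_pos (isCompact_Icc.image hg) hconv (by
    rintro _ ⟨p, hp, rfl⟩
    by_cases hT : ∀ T : Finset (Fin q), ∑ j ∈ T, p j ≤ w T
    · exact ⟨none, sub_pos.mpr (hno p hp.1 hT)⟩
    · push Not at hT
      obtain ⟨T, hT⟩ := hT
      exact ⟨some T, sub_pos.mpr hT⟩)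
  set γ := c none with hγ
  set β : Finset (Fin q) → ℝ := fun T => c (some T) with hβ
  have hval : ∀ p ∈ B, 0 < γ * (b - ∑ j, p j) +
      (∑ j, (∑ T with j ∈ T, β T) * p j - ∑ T, β T * w T) := by
    intro p hp
    have := hpos _ ⟨p, hp, rfl⟩
    rw [Fintype.sum_option] at this
    simpa only [g, Option.elim, mul_sub, Finset.sum_sub_distrib, ← sum_mul_sum_mem] using this
  have hβw : 0 ≤ ∑ T, β T * w T := Finset.sum_nonneg fun T _ => mul_nonneg (hc _) (hw T)
  have hγpos : 0 < γ := by
    refine (hc none).lt_of_ne fun h0 => ?_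
    have := hval 0 ⟨le_rfl, fun j => hw _⟩
    simp only [hγ, ← h0, Pi.zero_apply, mul_zero, Finset.sum_const_zero, zero_mul] at this
    linarith
  let d : Fin q → ℝ := fun j => max 0 (γ - ∑ T with j ∈ T, β T)
  have hd : ∀ j, 0 ≤ d j := fun j => le_max_left _ _
  let δ : Finset (Fin q) → ℝ := fun T => ∑ j, if T = {j} then d j else 0
  have hδ : ∀ T, 0 ≤ δ T := fun T => Finset.sum_nonneg fun j _ => by split_ifs <;> simp [hd]
  have hδj : ∀ j, d j ≤ ∑ T with j ∈ T, δ T := fun j => by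
    calc d j ≤ δ {j} := by simp [δ, Finset.singleton_inj]
      _ ≤ _ := Finset.single_le_sum (f := δ) (fun T _ => hδ T) (by simp)
  have hδw : ∑ T, δ T * w T = ∑ j, d j * w {j} := by
    simp only [δ, Finset.sum_mul]
    rw [Finset.sum_comm]
    simp
  have hcover := h (fun T => (β T + δ T) / γ) ⟨fun T => by
    have := hδ T
    have : 0 ≤ β T := hc _
    positivity, fun j => by
    rw [← Finset.sum_div, le_div_iff₀ hγpos, one_mul, Finset.sum_add_distrib]
    have h1 : γ - ∑ T with j ∈ T, β T ≤ d j := le_max_right _ _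
    linarith [hδj j]⟩
  have hcover' : γ * b ≤ ∑ T, β T * w T + ∑ j, d j * w {j} := by
    have heq : ∑ T, (β T + δ T) / γ * w T = (∑ T, β T * w T + ∑ T, δ T * w T) / γ := by
      rw [← Finset.sum_add_distrib, Finset.sum_div]
      exact Finset.sum_congr rfl fun T _ => by ring
    rw [heq, hδw, le_div_iff₀ hγpos] at hcover
    linarith
  let p : Fin q → ℝ := fun j => if 0 ≤ γ - ∑ T with j ∈ T, β T then w {j} else 0
  have hp : p ∈ B := by
    constructor <;> intro j <;> simp only [p] <;> split_ifs <;> simp [hw]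
  have hdp : ∑ j, d j * w {j} = γ * ∑ j, p j - ∑ j, (∑ T with j ∈ T, β T) * p j := by
    rw [Finset.mul_sum, ← Finset.sum_sub_distrib]
    refine Finset.sum_congr rfl fun j _ => ?_
    simp only [d, p]
    split_ifs with hj
    · rw [max_eq_right hj]; ring
    · rw [max_eq_left (not_le.mp hj).le]; ring
  have := hval p hp
  linarith

theorem qPartitioning_iff_dual (m q : ℕ) (hq : 2 ≤ q) (hqm : q ≤ m)
    (v : Finset (Fin m) → ℝ) (hv : IsValuation m v) :
    IsQPartitioning m q v ↔
    ∀ S P, IsPartitionInto m q S P →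
      ∃ p : Fin q → ℝ, (∀ j, 0 ≤ p j) ∧
        (∀ T : Finset (Fin q), ∑ j ∈ T, p j ≤ v (T.biUnion P)) ∧
        v S ≤ ∑ j : Fin q, p j := by
  constructor
  · intro h S P hP
    exact exists_prices_of_le_fractionalCover (fun T => v (T.biUnion P)) (fun T => hv.2.2 _) _
      (h S P hP)
  · intro h S P hP α hα
    obtain ⟨p, hp, hpT, hpS⟩ := h S P hP
    calc v S ≤ ∑ j, p j := hpS
      _ ≤ ∑ j, (∑ T with j ∈ T, α T) * p j :=
        Finset.sum_le_sum fun j _ => le_mul_of_one_le_left (hp j) (hα.2 j)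
      _ = ∑ T, α T * ∑ j ∈ T, p j := (sum_mul_sum_mem α p).symm
      _ ≤ ∑ T, α T * v (T.biUnion P) :=
        Finset.sum_le_sum fun T _ => mul_le_mul_of_nonneg_left (hpT T) (hα.1 T)
end

section
/- Every q-partitioning valuation v over [m] (2 ≤ q ≤ m) is subadditive and MPH-⌈m/q⌉: v(S∪T) ≤ v(S)+v(T) for all S,T ⊆ [m], and there exists a collection A of PH-⌈m/q⌉ valuations such that v(S) = max_{a∈A} a(S) for all S ⊆ [m]. -/
open Finset

/-- `a` is a PH-`k` valuation: a nonnegative weighted sum of hyperedges of size at most `k`. -/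
def IsPHk (m k : ℕ) (a : Finset (Fin m) → ℝ) : Prop :=
  ∃ w : Finset (Fin m) → ℝ, (∀ E, 0 ≤ w E) ∧ (∀ E, k < E.card → w E = 0) ∧
    ∀ S : Finset (Fin m), a S = ∑ T ∈ S.powerset, w T

/-- `f` is MPH-`k`: a pointwise maximum of a collection of PH-`k` valuations. -/
def IsMPHk (m k : ℕ) (f : Finset (Fin m) → ℝ) : Prop :=
  ∃ A : Set (Finset (Fin m) → ℝ), (∀ a ∈ A, IsPHk m k a) ∧
    ∀ S, IsGreatest ((fun a => a S) '' A) (f S)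

/-- Bondareva–Shapley: if no fractional cover of `ι` is cheaper than `V`, then `V` can be split into
nonnegative shares such that no coalition `T` is charged more than its cost `c T`. -/
theorem exists_core_of_le_fractional_cover {ι : Type*} [Fintype ι] [DecidableEq ι] [Nonempty ι]
    (c : Finset ι → ℝ) (hc : ∀ T, 0 ≤ c T) (V : ℝ) (hV : 0 ≤ V)
    (h : ∀ α : Finset ι → ℝ, (∀ T, 0 ≤ α T) →
      (∀ j, 1 ≤ ∑ T ∈ univ.filter (fun T : Finset ι => j ∈ T), α T) → V ≤ ∑ T, α T * c T) :
    ∃ p : ι → ℝ, (∀ j, 0 ≤ p j) ∧ (∀ T, ∑ j ∈ T, p j ≤ c T) ∧ ∑ j, p j = V := by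
  let L : (ι → ℝ) →ₗ[ℝ] (Finset ι → ℝ) :=
    { toFun := fun p T => V * ∑ j ∈ T, p j
      map_add' := fun p r => by ext T; simp [sum_add_distrib, mul_add]
      map_smul' := fun a p => by ext T; simp [← mul_sum, mul_left_comm] }
  by_cases hd : Disjoint (Set.Iic c) (L '' stdSimplex ℝ ι)
  · exfalso
    obtain ⟨f, u, w, hfu, huw, hwf⟩ := geometric_hahn_banach_closed_compact
      (convex_Iic c) isClosed_Iic ((convex_stdSimplex ℝ ι).linear_image L)
      ((isCompact_stdSimplex ℝ ι).image L.continuous_of_finiteDimensional) hd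
    let α : Finset ι → ℝ := fun T => f (Pi.single T 1)
    have hf : ∀ x, f x = ∑ T, α T * x T := fun x => by
      refine (f.toLinearMap.pi_apply_eq_sum_univ x).trans (sum_congr rfl fun T _ => ?_)
      have hT : (fun T' => if T = T' then (1 : ℝ) else 0) = Pi.single T 1 := by
        ext T'
        simp [Pi.single_apply, eq_comm]
      rw [smul_eq_mul, mul_comm, hT]
      rfl
    have hα : ∀ T, 0 ≤ α T := by
      intro T
      by_contra! hT
      have hfc := hfu c Set.self_mem_Iic
      have ht : 0 ≤ (u - f c) / (-α T) := div_nonneg (by linarith) (by linarith)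
      have hlt := hfu (c - ((u - f c) / (-α T)) • Pi.single T 1)
        (Set.mem_Iic.2 (sub_le_self c (smul_nonneg ht (Pi.single_nonneg.2 zero_le_one))))
      rw [map_sub, map_smul, smul_eq_mul] at hlt
      change f c - (u - f c) / (-α T) * α T < u at hlt
      have : (u - f c) / (-α T) * α T = -(u - f c) := by
        rw [div_neg, neg_mul, div_mul_cancel₀ _ hT.ne]
      linarith
    have hcost : ∀ j, ∑ T, α T * c T <
        V * ∑ T ∈ univ.filter (fun T : Finset ι => j ∈ T), α T := by
      intro j
      have hj := hwf _ ⟨_, single_mem_stdSimplex ℝ j, rfl⟩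
      have hLj : f (L (Pi.single j 1)) =
          V * ∑ T ∈ univ.filter (fun T : Finset ι => j ∈ T), α T := by
        rw [hf, sum_filter, mul_sum]
        refine sum_congr rfl fun T _ => ?_
        change α T * (V * ∑ i ∈ T, (Pi.single j 1 : ι → ℝ) i) = _
        rw [sum_pi_single']
        split_ifs <;> ring
      have hfc := hfu c Set.self_mem_Iic
      rw [hf c] at hfc
      linarith
    obtain ⟨i, -, hi⟩ := exists_min_image univ
      (fun j => ∑ T ∈ univ.filter (fun T : Finset ι => j ∈ T), α T) univ_nonempty
    set β := ∑ T ∈ univ.filter (fun T : Finset ι => i ∈ T), α T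
    have hαc : 0 ≤ ∑ T, α T * c T := sum_nonneg fun T _ => mul_nonneg (hα T) (hc T)
    have hβ : 0 < β := pos_of_mul_pos_right (hαc.trans_lt (hcost i)) hV
    have hcover := h (fun T => α T / β) (fun T => div_nonneg (hα T) hβ.le) fun j => by
      rw [← sum_div, one_le_div hβ]
      exact hi j (mem_univ j)
    simp only [div_mul_eq_mul_div] at hcover
    rw [← sum_div, le_div_iff₀ hβ] at hcover
    exact (hcost i).not_ge hcover
  · obtain ⟨-, hx, p, hp, rfl⟩ := Set.not_disjoint_iff.1 hd
    refine ⟨fun j => V * p j, fun j => mul_nonneg hV (hp.1 j), fun T => ?_, ?_⟩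
    · rw [← mul_sum]
      exact hx T
    · rw [← mul_sum, hp.2, mul_one]

/-- A subset of `[m]` splits into `q` parts of size at most `k` as soon as `m ≤ q * k`. -/
theorem exists_isPartitionInto_card_le {m q k : ℕ} (hmk : m ≤ q * k) (S : Finset (Fin m)) :
    ∃ P : Fin q → Finset (Fin m), IsPartitionInto m q S P ∧ ∀ j, (P j).card ≤ k := by
  refine ⟨fun j => S.filter fun x => x.val / k = j.val, ⟨fun i j hij => ?_, ?_⟩, fun j => ?_⟩
  · refine disjoint_filter.2 fun x _ hi hj => hij (Fin.ext (hi.symm.trans hj))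
  · ext x
    simp only [mem_biUnion, mem_univ, true_and, mem_filter]
    refine ⟨fun ⟨_, hx, _⟩ => hx, fun hx => ⟨⟨x.val / k, ?_⟩, hx, rfl⟩⟩
    exact Nat.div_lt_of_lt_mul (by rw [mul_comm]; exact x.isLt.trans_le hmk)
  · calc (S.filter fun x => x.val / k = j.val).card
        ≤ (Ico (j.val * k) (j.val * k + k)).card := by
          refine card_le_card_of_injOn Fin.val (fun x hx => ?_) Fin.val_injective.injOn
          have hxj : x.val / k = j.val := (mem_filter.1 hx).2
          have hk : 0 < k := by
            rcases Nat.eq_zero_or_pos k with rfl | hk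
            · have := x.isLt
              omega
            · exact hk
          rw [coe_Ico, Set.mem_Ico]
          have := (Nat.div_eq_iff hk).1 hxj
          omega
      _ = k := by simp

/-- Placing weight `p j` on the set `P j` gives a PH-`k` valuation when all `P j` have size at
most `k`. -/
theorem isPHk_sum_ite_subset {m q k : ℕ} (P : Fin q → Finset (Fin m)) (hP : ∀ j, (P j).card ≤ k)
    (p : Fin q → ℝ) (hp : ∀ j, 0 ≤ p j) :
    IsPHk m k fun U => ∑ j ∈ univ.filter (fun j => P j ⊆ U), p j := by
  refine ⟨fun E => ∑ j ∈ univ.filter (fun j => P j = E), p j,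
    fun E => sum_nonneg fun j _ => hp j, fun E hE => ?_, fun U => ?_⟩
  · refine sum_eq_zero fun j hj => ?_
    obtain rfl := (mem_filter.1 hj).2
    exact absurd (hP j) hE.not_ge
  · simp only [sum_filter]
    rw [sum_comm]
    refine sum_congr rfl fun j _ => ?_
    rw [sum_ite_eq]
    simp only [mem_powerset]

theorem IsQPartitioning.subadditive {m q : ℕ} (hq : 2 ≤ q) {v : Finset (Fin m) → ℝ}
    (hv : IsValuation m v) (hQ : IsQPartitioning m q v) (S T : Finset (Fin m)) :
    v (S ∪ T) ≤ v S + v T := by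
  let a : Fin q := ⟨0, by omega⟩
  let b : Fin q := ⟨1, by omega⟩
  have hab : a ≠ b := by simp [a, b]
  let P : Fin q → Finset (Fin m) := fun j => if j = a then S else if j = b then T \ S else ∅
  have hP : IsPartitionInto m q (S ∪ T) P := by
    constructor
    · intro i j hij
      rw [disjoint_left]
      intro x
      simp only [P]
      split_ifs <;> simp_all
    · ext x
      simp only [mem_biUnion, mem_univ, true_and, mem_union]
      constructor
      · rintro ⟨j, hj⟩
        simp only [P] at hj
        split_ifs at hj <;> simp_all
      · intro hx
        by_cases hS : x ∈ S
        · exact ⟨a, by simpa [P] using hS⟩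
        · exact ⟨b, by simpa [P, hab.symm, hS] using hx⟩
  have hcover := hQ _ P hP
    (fun U => (if U = {a} then 1 else 0) + if U = univ.erase a then 1 else 0)
    ⟨fun U => by positivity, fun j => by
      rw [sum_add_distrib, sum_ite_eq', sum_ite_eq']
      by_cases hj : j = a <;> simp [hj]⟩
  simp only [add_mul, ite_mul, one_mul, zero_mul, sum_add_distrib, sum_ite_eq', mem_univ,
    if_true] at hcover
  refine hcover.trans (add_le_add (hv.2.1 _ _ ?_) (hv.2.1 _ _ ?_))
  · simp [P]
  · refine biUnion_subset.2 fun j hj => ?_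
    simp only [P, if_neg (ne_of_mem_erase hj)]
    split_ifs
    · exact sdiff_subset
    · exact empty_subset T

theorem IsQPartitioning.exists_isPHk_le {m q k : ℕ} (hq : 0 < q) (hmk : m ≤ q * k)
    {v : Finset (Fin m) → ℝ} (hv : IsValuation m v) (hQ : IsQPartitioning m q v)
    (S : Finset (Fin m)) :
    ∃ a, IsPHk m k a ∧ (∀ U, a U ≤ v U) ∧ a S = v S := by
  have : Nonempty (Fin q) := ⟨⟨0, hq⟩⟩
  obtain ⟨P, hP, hcard⟩ := exists_isPartitionInto_card_le hmk S
  obtain ⟨p, hp, hpv, hsum⟩ := exists_core_of_le_fractional_cover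
    (fun T : Finset (Fin q) => v (T.biUnion P)) (fun T => hv.2.2 _) (v S) (hv.2.2 S)
    fun α hα hcov => hQ S P hP α ⟨hα, hcov⟩
  refine ⟨_, isPHk_sum_ite_subset P hcard p hp, fun U => (hpv _).trans (hv.2.1 _ _ ?_), ?_⟩
  · exact biUnion_subset.2 fun j hj => (mem_filter.1 hj).2
  · have hPS : ∀ j, P j ⊆ S := fun j => hP.2 ▸ subset_biUnion_of_mem P (mem_univ j)
    simp only [hPS, filter_true, hsum]

theorem qPartitioning_subadditive_MPH (m q : ℕ) (hq : 2 ≤ q) (hqm : q ≤ m)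
    (v : Finset (Fin m) → ℝ) (hv : IsValuation m v) (hQ : IsQPartitioning m q v) :
    (∀ S T : Finset (Fin m), v (S ∪ T) ≤ v S + v T) ∧
    IsMPHk m ((m + q - 1) / q) v := by
  refine ⟨hQ.subadditive hq hv, {a | IsPHk m _ a ∧ ∀ U, a U ≤ v U}, fun a ha => ha.1,
    fun S => ⟨?_, ?_⟩⟩
  · have hmk : m ≤ q * ((m + q - 1) / q) := by
      have := Nat.div_add_mod (m + q - 1) q
      have := Nat.mod_lt (m + q - 1) (show 0 < q by omega)
      omega
    obtain ⟨a, ha, hle, haS⟩ := hQ.exists_isPHk_le (by omega) hmk hv S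
    exact ⟨a, ⟨ha, hle⟩, haS⟩
  · rintro _ ⟨a, ha, rfl⟩
    exact ha.2 S
end

section
/- There is a universal constant C > 0 such that the following holds. Let m ≥ 33, let 4 ≤ q ≤ m, and let v be a q-partitioning valuation over [m]. Then there exists a real number p ∈ [0,1] such that sup_{λ∈Δ(p)} inf_{μ∈Δ(p)} E_{S←λ, T←μ}[v(S∖T)] ≥ C·(log₂log₂ q / log₂log₂ m)·v([m]), where S and T are drawn independently from λ and μ respectively. -/
open Finset

/-- `Δ(p)`: distributions over `2^[m]` in which each item appears with probability at most `p`. -/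
def DeltaSet (m : ℕ) (p : ℝ) : Set (Finset (Fin m) → ℝ) :=
  {l | (∀ S, 0 ≤ l S) ∧ (∑ S : Finset (Fin m), l S) = 1 ∧
    ∀ i : Fin m, ∑ S ∈ Finset.univ.filter (fun S : Finset (Fin m) => i ∈ S), l S ≤ p}

/-- In a `q`-partitioning valuation, colouring the items with `q` colours turns every weighted
family of colour sets covering all colours into an upper bound. -/
lemma IsQPartitioning.le_sum_of_cover {m q : ℕ} {v : Finset (Fin m) → ℝ}
    (hv : IsQPartitioning m q v) {ι : Type*} [Fintype ι] (c : Fin m → Fin q)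
    (A : ι → Finset (Fin q)) (w : ι → ℝ) (hw : ∀ i, 0 ≤ w i)
    (hA : ∀ k, 1 ≤ ∑ i, if k ∈ A i then w i else 0) (S : Finset (Fin m)) :
    v S ≤ ∑ i, w i * v (S.filter fun x => c x ∈ A i) := by
  classical
  have hP : IsPartitionInto m q S (fun k => S.filter fun x => c x = k) := by
    refine ⟨fun i j hij => ?_, ?_⟩
    · rw [Finset.disjoint_left]
      intro x hx hx'
      simp only [mem_filter] at hx hx'
      exact hij (hx.2.symm.trans hx'.2)
    · ext x
      simp
  have hα : IsFractionalCover q (fun T => ∑ i, if A i = T then w i else 0) := by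
    refine ⟨fun T => Finset.sum_nonneg fun i _ => by split_ifs <;> simp [hw], fun k => ?_⟩
    refine (hA k).trans_eq ?_
    rw [Finset.sum_comm]
    refine Finset.sum_congr rfl fun i _ => ?_
    rw [Finset.sum_ite_eq]
    simp
  refine (hv S _ hP _ hα).trans_eq ?_
  simp_rw [Finset.sum_mul]
  rw [Finset.sum_comm]
  refine Finset.sum_congr rfl fun i _ => ?_
  simp_rw [ite_mul, zero_mul]
  rw [Finset.sum_ite_eq]
  simp only [mem_univ, if_true]
  congr 2
  ext x
  simp [and_comm]

/-- The items of `S` lying in at least `s` of the sets `T j`. -/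
def frequentItems {m r : ℕ} (s : ℕ) (S : Finset (Fin m)) (T : Fin r → Finset (Fin m)) :
    Finset (Fin m) :=
  S.filter fun x => s ≤ (univ.filter fun j => x ∈ T j).card

/-- If `2 ^ r ≤ q`, a `q`-partitioning valuation of `S` is bounded by twice the average value of
`S \ T j` plus the value of the items lying in at least half of the `T j`. -/
lemma IsQPartitioning.le_average_sdiff_add_frequentItems {m q r s : ℕ}
    {v : Finset (Fin m) → ℝ} (hv : IsQPartitioning m q v) (hr : 0 < r) (hrq : 2 ^ r ≤ q)
    (hs : 2 * s ≤ r + 1) (S : Finset (Fin m)) (T : Fin r → Finset (Fin m)) :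
    v S ≤ ∑ j, 2 / (r : ℝ) * v (S \ T j) + v (frequentItems s S T) := by
  classical
  have hcard : Fintype.card (Finset (Fin r)) ≤ Fintype.card (Fin q) := by simpa using hrq
  obtain ⟨e⟩ := Function.Embedding.nonempty_of_card_le hcard
  set f : Fin q → Finset (Fin r) := Function.invFun e
  have hf : ∀ B, f (e B) = B := Function.leftInverse_invFun e.injective
  have hr' : (0 : ℝ) < r := by exact_mod_cast hr
  have key := hv.le_sum_of_cover (ι := Option (Fin r))
    (fun x => e (univ.filter fun j => x ∈ T j))
    (fun o => o.elim (univ.filter fun k => s ≤ (f k).card) fun j => univ.filter fun k => j ∉ f k)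
    (fun o => o.elim 1 fun _ => 2 / (r : ℝ))
    (fun o => by cases o <;> simp; positivity) ?_ S
  · refine key.trans_eq ?_
    rw [Fintype.sum_option, add_comm]
    congr 1
    · refine Finset.sum_congr rfl fun j _ => ?_
      simp only [Option.elim]
      congr 2
      ext x
      simp [hf]
    · simp [frequentItems, hf]
  · intro k
    rw [Fintype.sum_option]
    simp only [Option.elim, mem_filter, mem_univ, true_and]
    by_cases hk : s ≤ (f k).card
    · rw [if_pos hk]
      have : 0 ≤ ∑ j : Fin r, if j ∉ f k then 2 / (r : ℝ) else 0 :=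
        Finset.sum_nonneg fun j _ => by split_ifs <;> positivity
      linarith
    · rw [if_neg hk, zero_add, ← Finset.sum_filter, Finset.sum_const, nsmul_eq_mul]
      have h1 : (univ.filter fun j => j ∉ f k) = (f k)ᶜ := by
        ext j
        simp
      have h2 : (f k).card + (f k)ᶜ.card = r := by simp
      have h3 : r ≤ 2 * (f k)ᶜ.card := by omega
      have h4 : (r : ℝ) ≤ 2 * ((f k)ᶜ.card : ℝ) := by exact_mod_cast h3
      rw [h1, mul_div_assoc', le_div_iff₀ hr']
      linarith

/-- Independent draws: the expectation of a product is the product of the expectations. -/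
lemma sum_prod_mul_prod {X : Type*} [Fintype X] {r : ℕ} (u : X → ℝ) (h : Fin r → X → ℝ) :
    ∑ T : Fin r → X, (∏ j, u (T j)) * ∏ j, h j (T j) = ∏ j, ∑ x, u x * h j x := by
  classical
  rw [Finset.prod_univ_sum]
  simp [Finset.prod_mul_distrib]

lemma sum_prod_eq_one {X : Type*} [Fintype X] {r : ℕ} {u : X → ℝ} (hu : ∑ x, u x = 1) :
    ∑ T : Fin r → X, ∏ j, u (T j) = 1 := by
  simpa [hu] using sum_prod_mul_prod u (fun (_ : Fin r) _ => (1 : ℝ))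

lemma sum_prod_mul_apply {X : Type*} [Fintype X] {r : ℕ} {u : X → ℝ} (hu : ∑ x, u x = 1)
    (j : Fin r) (F : X → ℝ) :
    ∑ T : Fin r → X, (∏ i, u (T i)) * F (T j) = ∑ x, u x * F x := by
  classical
  have h := sum_prod_mul_prod u (fun (i : Fin r) x => if i = j then F x else 1)
  simp only [Finset.prod_ite_eq', mem_univ, if_true] at h
  rw [h, Finset.prod_eq_single j]
  · simp
  · intro i _ hij
    simp [hij, hu]
  · simp

/-- The probability that an item lies in at least `s` of `r` independent draws. -/
lemma sum_prod_frequent_le {m r s : ℕ} {p : ℝ} (hp : 0 < p) (hp1 : p ≤ 1)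
    {u : Finset (Fin m) → ℝ} (hu : u ∈ DeltaSet m p) (x : Fin m) :
    ∑ T : Fin r → Finset (Fin m),
      (if s ≤ (univ.filter fun j => x ∈ T j).card then ∏ j, u (T j) else 0) ≤ 2 ^ r * p ^ s := by
  classical
  obtain ⟨hu0, hu1, hup⟩ := hu
  have hone : (1 : ℝ) ≤ 1 / p := by rwa [le_div_iff₀ hp, one_mul]
  have hpt : ∀ T : Fin r → Finset (Fin m),
      (if s ≤ (univ.filter fun j => x ∈ T j).card then ∏ j, u (T j) else 0) ≤
        p ^ s * ((∏ j, u (T j)) * ∏ j, (1 + if x ∈ T j then 1 / p else 0)) := by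
    intro T
    have hprod : 0 ≤ ∏ j, u (T j) := Finset.prod_nonneg fun j _ => hu0 _
    have hfac : ∀ j, (0 : ℝ) ≤ 1 + if x ∈ T j then 1 / p else 0 := fun j => by
      split_ifs <;> positivity
    split_ifs with hN
    · have h1 : (1 / p) ^ s ≤ ∏ j, (1 + if x ∈ T j then 1 / p else 0) := by
        calc (1 / p) ^ s ≤ (1 / p) ^ (univ.filter fun j => x ∈ T j).card :=
              pow_le_pow_right₀ hone hN
          _ = ∏ j, (if x ∈ T j then 1 / p else 1) := by
              rw [Finset.prod_ite]
              simp
          _ ≤ _ := by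
              refine Finset.prod_le_prod (fun j _ => ?_) fun j _ => ?_
              · split_ifs <;> positivity
              · split_ifs <;> simp
      have h2 : 1 ≤ p ^ s * ∏ j, (1 + if x ∈ T j then 1 / p else 0) := by
        calc (1 : ℝ) = p ^ s * (1 / p) ^ s := by rw [← mul_pow]; field_simp; simp
          _ ≤ _ := by gcongr
      nlinarith [mul_le_mul_of_nonneg_left h2 hprod]
    · have := Finset.prod_nonneg fun j (_ : j ∈ univ) => hfac j
      positivity
  have hE : ∑ S, u S * (1 + if x ∈ S then 1 / p else 0) ≤ 2 := by
    simp_rw [mul_add, mul_one, mul_ite, mul_zero]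
    rw [Finset.sum_add_distrib, hu1, ← Finset.sum_filter, ← Finset.sum_mul]
    have : (∑ S ∈ univ.filter (fun S : Finset (Fin m) => x ∈ S), u S) * (1 / p) ≤ p * (1 / p) :=
      mul_le_mul_of_nonneg_right (hup x) (by positivity)
    have hpp : p * (1 / p) = 1 := by field_simp
    linarith
  have hE0 : 0 ≤ ∑ S, u S * (1 + if x ∈ S then 1 / p else 0) :=
    Finset.sum_nonneg fun S _ => mul_nonneg (hu0 S) (by split_ifs <;> positivity)
  refine (Finset.sum_le_sum fun T _ => hpt T).trans ?_
  rw [← Finset.mul_sum, sum_prod_mul_prod u (fun _ S => 1 + if x ∈ S then 1 / p else 0),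
    Finset.prod_const, Finset.card_univ, Fintype.card_fin, mul_comm]
  gcongr

/-- One round: against any opponent `u`, part of the value of `l` is kept by `S \ T`, and the rest
is carried over to a distribution with much smaller marginals. -/
lemma IsQPartitioning.exists_sparser {m q r s : ℕ} {p : ℝ} {v : Finset (Fin m) → ℝ}
    (hv : IsQPartitioning m q v) (hr : 0 < r) (hrq : 2 ^ r ≤ q) (hs : 2 * s ≤ r + 1)
    (hp : 0 < p) (hp1 : p ≤ 1) {l u : Finset (Fin m) → ℝ}
    (hl : l ∈ DeltaSet m p) (hu : u ∈ DeltaSet m p) :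
    ∃ l' ∈ DeltaSet m (p * (2 ^ r * p ^ s)),
      ∑ S, l S * v S ≤ 2 * (∑ S, ∑ T, l S * u T * v (S \ T)) + ∑ S, l' S * v S := by
  classical
  have hl' := hl
  obtain ⟨hl0, hl1, hlp⟩ := hl'
  have hu' := hu
  obtain ⟨hu0, hu1, -⟩ := hu'
  have hr' : (0 : ℝ) < r := by exact_mod_cast hr
  set W : Finset (Fin m) → (Fin r → Finset (Fin m)) → ℝ := fun S T => l S * ∏ j, u (T j) with hW
  have hW0 : ∀ S T, 0 ≤ W S T := fun S T =>
    mul_nonneg (hl0 S) (Finset.prod_nonneg fun j _ => hu0 _)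
  have hpush : ∀ F : Finset (Fin m) → ℝ,
      ∑ A, (∑ S, ∑ T, if frequentItems s S T = A then W S T else 0) * F A =
        ∑ S, ∑ T, W S T * F (frequentItems s S T) := by
    intro F
    simp_rw [Finset.sum_mul]
    rw [Finset.sum_comm]
    refine Finset.sum_congr rfl fun S _ => ?_
    rw [Finset.sum_comm]
    refine Finset.sum_congr rfl fun T _ => ?_
    simp_rw [ite_mul, zero_mul]
    rw [Finset.sum_ite_eq]
    simp
  have hWsum : ∑ S, ∑ T, W S T = 1 := by
    simp_rw [hW, ← Finset.mul_sum, sum_prod_eq_one hu1, mul_one, hl1]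
  refine ⟨fun A => ∑ S, ∑ T, if frequentItems s S T = A then W S T else 0, ⟨?_, ?_, ?_⟩, ?_⟩
  · exact fun A => Finset.sum_nonneg fun S _ => Finset.sum_nonneg fun T _ => by
      split_ifs
      · exact hW0 S T
      · exact le_rfl
  · simpa [hWsum] using hpush fun _ => 1
  · intro x
    have h := hpush fun A => if x ∈ A then 1 else 0
    simp_rw [mul_ite, mul_one, mul_zero] at h
    rw [Finset.sum_filter, h]
    calc ∑ S, ∑ T, (if x ∈ frequentItems s S T then W S T else 0)
        = ∑ S, (if x ∈ S then l S else 0) * ∑ T : Fin r → Finset (Fin m),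
            (if s ≤ (univ.filter fun j => x ∈ T j).card then ∏ j, u (T j) else 0) := by
          refine Finset.sum_congr rfl fun S _ => ?_
          rw [Finset.mul_sum]
          refine Finset.sum_congr rfl fun T _ => ?_
          simp only [frequentItems, mem_filter, hW]
          split_ifs <;> simp_all
      _ ≤ ∑ S, (if x ∈ S then l S else 0) * (2 ^ r * p ^ s) := by
          refine Finset.sum_le_sum fun S _ => ?_
          refine mul_le_mul_of_nonneg_left (sum_prod_frequent_le hp hp1 hu x) ?_
          split_ifs
          · exact hl0 S
          · exact le_rfl
      _ ≤ p * (2 ^ r * p ^ s) := by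
          rw [← Finset.sum_mul, ← Finset.sum_filter]
          exact mul_le_mul_of_nonneg_right (hlp x) (by positivity)
  · rw [hpush v]
    calc ∑ S, l S * v S = ∑ S, ∑ T, W S T * v S := by
          refine Finset.sum_congr rfl fun S _ => ?_
          rw [← Finset.sum_mul]
          simp_rw [hW, ← Finset.mul_sum, sum_prod_eq_one hu1, mul_one]
      _ ≤ ∑ S, ∑ T, (W S T * ∑ j, 2 / (r : ℝ) * v (S \ T j) +
            W S T * v (frequentItems s S T)) := by
          refine Finset.sum_le_sum fun S _ => Finset.sum_le_sum fun T _ => ?_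
          rw [← mul_add]
          exact mul_le_mul_of_nonneg_left
            (hv.le_average_sdiff_add_frequentItems hr hrq hs S T) (hW0 S T)
      _ = 2 * (∑ S, ∑ T, l S * u T * v (S \ T)) +
            ∑ S, ∑ T, W S T * v (frequentItems s S T) := by
          simp_rw [Finset.sum_add_distrib]
          congr 1
          rw [Finset.mul_sum]
          refine Finset.sum_congr rfl fun S _ => ?_
          simp_rw [Finset.mul_sum]
          rw [Finset.sum_comm]
          have hj : ∀ j : Fin r, ∑ T : Fin r → Finset (Fin m),
              W S T * (2 / (r : ℝ) * v (S \ T j)) =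
                2 / (r : ℝ) * (l S * ∑ T, u T * v (S \ T)) := by
            intro j
            rw [← sum_prod_mul_apply hu1 j fun B => v (S \ B), Finset.mul_sum, Finset.mul_sum]
            refine Finset.sum_congr rfl fun T _ => ?_
            simp only [hW]
            ring
          simp_rw [hj]
          rw [Finset.sum_const, Finset.card_univ, Fintype.card_fin, nsmul_eq_mul,
            ← mul_assoc, mul_div_cancel₀ _ hr'.ne', Finset.mul_sum, Finset.mul_sum]
          refine Finset.sum_congr rfl fun T _ => ?_
          ring

lemma DeltaSet_mono {m : ℕ} {p p' : ℝ} (h : p ≤ p') : DeltaSet m p ⊆ DeltaSet m p' :=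
  fun _ hl => ⟨hl.1, hl.2.1, fun i => (hl.2.2 i).trans h⟩

/-- Playing the full set with probability `p` and the empty set otherwise. -/
lemma exists_mem_DeltaSet_le {m : ℕ} {p : ℝ} (hp : 0 ≤ p) (hp1 : p ≤ 1)
    {v : Finset (Fin m) → ℝ} (hv : ∀ S, 0 ≤ v S) :
    ∃ l ∈ DeltaSet m p, p * v univ ≤ ∑ S, l S * v S := by
  classical
  have hq : 0 ≤ 1 - p := by linarith
  refine ⟨fun S => (if S = univ then p else 0) + if S = ∅ then 1 - p else 0,
    ⟨fun S => by positivity, ?_, fun i => ?_⟩, ?_⟩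
  · simp [Finset.sum_add_distrib]
  · rw [Finset.sum_filter]
    have : ∀ S : Finset (Fin m), (if i ∈ S then (if S = univ then p else 0) +
        (if S = ∅ then 1 - p else 0) else 0) = if S = univ then p else 0 := by
      intro S
      by_cases h1 : S = univ
      · have h2 : S ≠ ∅ := by rintro rfl; exact absurd (h1 ▸ mem_univ i) (by simp)
        simp [h1]
        intro h3
        exact absurd (h1.trans h3) h2
      · by_cases h2 : S = ∅ <;> simp [h1, h2]
        intro h3
        exact absurd (h2.trans h3) h1
    simp_rw [this]
    simp
  · simp only [add_mul, Finset.sum_add_distrib, ite_mul, zero_mul, Finset.sum_ite_eq',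
      mem_univ, if_true]
    nlinarith [hv ∅]

lemma IsValuation.sum_le_of_mem_DeltaSet {m : ℕ} {p : ℝ} {v : Finset (Fin m) → ℝ}
    (hv : IsValuation m v) {l : Finset (Fin m) → ℝ} (hl : l ∈ DeltaSet m p) :
    ∑ S, l S * v S ≤ m * p * v univ := by
  classical
  obtain ⟨h0, hmono, hnn⟩ := hv
  obtain ⟨hl0, hl1, hlp⟩ := hl
  calc ∑ S, l S * v S ≤ ∑ S, (∑ i : Fin m, if i ∈ S then l S else 0) * v univ := by
        refine Finset.sum_le_sum fun S _ => ?_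
        rw [← Finset.sum_filter, Finset.sum_const, nsmul_eq_mul]
        rcases S.eq_empty_or_nonempty with rfl | hS
        · simp [h0]
        · have h1 : (1 : ℝ) ≤ ((univ.filter fun i => i ∈ S).card : ℝ) := by
            have : 0 < (univ.filter fun i => i ∈ S).card := by simpa using hS
            exact_mod_cast this
          have h2 := hmono S univ (subset_univ S)
          have h3 := mul_le_mul_of_nonneg_left h2 (hl0 S)
          have h4 := mul_nonneg (hl0 S) (hnn univ)
          nlinarith
    _ = (∑ i : Fin m, ∑ S ∈ univ.filter (fun S : Finset (Fin m) => i ∈ S), l S) * v univ := by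
        rw [← Finset.sum_mul, Finset.sum_comm]
        simp_rw [Finset.sum_filter]
    _ ≤ (∑ _i : Fin m, p) * v univ :=
        mul_le_mul_of_nonneg_right (Finset.sum_le_sum fun i _ => hlp i) (hnn univ)
    _ = m * p * v univ := by simp

/-- If the game has value less than `c`, every strategy `l` has a reply `u` keeping the payoff
below `c`. -/
lemma IsValuation.exists_reply {m : ℕ} {p c : ℝ} {v : Finset (Fin m) → ℝ}
    (hv : IsValuation m v) (hp : 0 ≤ p)
    (h : sSup {x : ℝ | ∃ l ∈ DeltaSet m p, x =
      sInf {y : ℝ | ∃ u ∈ DeltaSet m p, y =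
        ∑ S : Finset (Fin m), ∑ T : Finset (Fin m), l S * u T * v (S \ T)}} < c)
    {l : Finset (Fin m) → ℝ} (hl : l ∈ DeltaSet m p) :
    ∃ u ∈ DeltaSet m p, ∑ S, ∑ T, l S * u T * v (S \ T) < c := by
  classical
  obtain ⟨h0, hmono, hnn⟩ := hv
  set δ : Finset (Fin m) → ℝ := fun S => if S = ∅ then 1 else 0
  have hδ : δ ∈ DeltaSet m p := by
    refine ⟨fun S => by simp only [δ]; positivity, by simp [δ], fun i => ?_⟩
    refine le_of_eq_of_le (Finset.sum_eq_zero fun S hS => ?_) hp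
    have : S ≠ ∅ := Finset.ne_empty_of_mem (mem_filter.1 hS).2
    simp [δ, this]
  have hpay0 : ∀ l ∈ DeltaSet m p, ∀ u ∈ DeltaSet m p,
      0 ≤ ∑ S, ∑ T, l S * u T * v (S \ T) := fun l hl u hu =>
    Finset.sum_nonneg fun S _ => Finset.sum_nonneg fun T _ =>
      mul_nonneg (mul_nonneg (hl.1 S) (hu.1 T)) (hnn _)
  have hbdd : BddAbove {x : ℝ | ∃ l ∈ DeltaSet m p, x =
      sInf {y : ℝ | ∃ u ∈ DeltaSet m p, y =
        ∑ S : Finset (Fin m), ∑ T : Finset (Fin m), l S * u T * v (S \ T)}} := by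
    refine ⟨v univ, ?_⟩
    rintro _ ⟨l, hl, rfl⟩
    refine le_trans (b := ∑ S, ∑ T, l S * δ T * v (S \ T)) (csInf_le ?_ ⟨δ, hδ, rfl⟩) ?_
    · refine ⟨0, ?_⟩
      rintro _ ⟨u, hu, rfl⟩
      exact hpay0 l hl u hu
    · calc ∑ S, ∑ T, l S * δ T * v (S \ T) = ∑ S, l S * v S := by simp [δ]
        _ ≤ ∑ S, l S * v univ := Finset.sum_le_sum fun S _ =>
            mul_le_mul_of_nonneg_left (hmono _ _ (subset_univ S)) (hl.1 S)
        _ = v univ := by rw [← Finset.sum_mul, hl.2.1, one_mul]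
  obtain ⟨_, ⟨u, hu, rfl⟩, hlt⟩ :=
    exists_lt_of_csInf_lt (by exact ⟨_, δ, hδ, rfl⟩) ((le_csSup hbdd ⟨l, hl, rfl⟩).trans_lt h)
  exact ⟨u, hu, hlt⟩

lemma mul_two_pow_mul_pow_le_rpow {p : ℝ} (hp : 0 < p) (hp16 : p ≤ 1 / 16) {r s : ℕ}
    (hrs : r ≤ 2 * s) : p * (2 ^ r * p ^ s) ≤ p ^ (1 + (s : ℝ) / 2) := by
  have h4 : 4 * p ≤ p ^ (1 / 2 : ℝ) := by
    rw [← Real.sqrt_eq_rpow]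
    refine Real.le_sqrt_of_sq_le ?_
    nlinarith
  rw [Real.rpow_add hp, Real.rpow_one]
  refine mul_le_mul_of_nonneg_left ?_ hp.le
  calc (2 : ℝ) ^ r * p ^ s ≤ 2 ^ (2 * s) * p ^ s := by
        gcongr
        norm_num
    _ = (4 * p) ^ s := by rw [pow_mul, mul_pow]; norm_num
    _ ≤ (p ^ (1 / 2 : ℝ)) ^ s := by gcongr
    _ = p ^ ((s : ℝ) / 2) := by
        rw [← Real.rpow_natCast, ← Real.rpow_mul hp.le]
        ring_nf

/-- Iterating the round `K` times when the game has small value for every `p`. -/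
lemma IsQPartitioning.exists_sparse_of_value_lt {m q r s : ℕ} {c : ℝ}
    {v : Finset (Fin m) → ℝ} (hq : IsQPartitioning m q v)
    (hr : 0 < r) (hrq : 2 ^ r ≤ q) (hs : 2 * s ≤ r + 1) (hrs : r ≤ 2 * s) (hnn : ∀ S, 0 ≤ v S)
    (h : ∀ p : ℝ, 0 ≤ p → p ≤ 1 → ∀ l ∈ DeltaSet m p,
      ∃ u ∈ DeltaSet m p, ∑ S, ∑ T, l S * u T * v (S \ T) < c) (K : ℕ) :
    ∃ l ∈ DeltaSet m ((1 / 16 : ℝ) ^ ((1 + (s : ℝ) / 2) ^ K)),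
      1 / 16 * v univ ≤ 2 * c * K + ∑ S, l S * v S := by
  induction K with
  | zero =>
    obtain ⟨l, hl, hle⟩ := exists_mem_DeltaSet_le (p := 1 / 16) (by norm_num) (by norm_num) hnn
    exact ⟨l, by simpa using hl, by simpa using hle⟩
  | succ K ih =>
    obtain ⟨l, hl, hle⟩ := ih
    set p : ℝ := (1 / 16 : ℝ) ^ ((1 + (s : ℝ) / 2) ^ K) with hp
    have hp0 : 0 < p := by positivity
    have hp16 : p ≤ 1 / 16 := by
      have h1 : (1 : ℝ) ≤ (1 + (s : ℝ) / 2) ^ K := one_le_pow₀ (by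
        have : (0 : ℝ) ≤ s := by positivity
        linarith)
      calc p ≤ (1 / 16 : ℝ) ^ (1 : ℝ) :=
            Real.rpow_le_rpow_of_exponent_ge (by norm_num) (by norm_num) h1
        _ = 1 / 16 := Real.rpow_one _
    have hp1 : p ≤ 1 := by linarith
    obtain ⟨u, hu, hlt⟩ := h p hp0.le hp1 l hl
    obtain ⟨l', hl', hle'⟩ := hq.exists_sparser hr hrq hs hp0 hp1 hl hu
    refine ⟨l', DeltaSet_mono ?_ hl', ?_⟩
    · rw [pow_succ, Real.rpow_mul (by norm_num)]
      exact mul_two_pow_mul_pow_le_rpow hp0 hp16 hrs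
    · push_cast
      linarith

lemma logb_le_one_add_div_two_pow_four {q r s : ℕ} (hq : 0 < q) (hqr : q < 2 ^ (r + 1))
    (hrs : r ≤ 2 * s) : Real.logb 2 q ≤ (1 + (s : ℝ) / 2) ^ 4 := by
  have h1 : Real.logb 2 q ≤ r + 1 := by
    rw [Real.logb_le_iff_le_rpow (by norm_num) (by exact_mod_cast hq)]
    exact_mod_cast hqr.le
  have h2 : (r : ℝ) ≤ 2 * s := by exact_mod_cast hrs
  have h3 : (0 : ℝ) ≤ s := by positivity
  have h4 := one_add_mul_le_pow (a := (s : ℝ) / 2) (by linarith) 4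
  push_cast at h4
  linarith

/-- After `K ≈ 4 log log m / log log q` rounds the marginals are below `1 / (32 m)`. -/
lemma mul_rpow_le_of_logb_le {m K : ℕ} {t : ℝ} (hm : 33 ≤ m) (ht : Real.logb 2 m ≤ t ^ K) :
    (m : ℝ) * (1 / 16 : ℝ) ^ (t ^ K) ≤ 1 / 32 := by
  have hm' : (33 : ℝ) ≤ m := by exact_mod_cast hm
  have hm0 : (0 : ℝ) < m := by linarith
  have h1 : (1 / 16 : ℝ) ^ (t ^ K) ≤ (1 / 16 : ℝ) ^ (Real.logb 2 m) :=
    Real.rpow_le_rpow_of_exponent_ge (by norm_num) (by norm_num) ht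
  have h2 : (1 / 16 : ℝ) ^ (Real.logb 2 m) = ((m : ℝ) ^ 4)⁻¹ := by
    have h16 : (1 / 16 : ℝ) = ((2 : ℝ) ^ (4 : ℝ))⁻¹ := by norm_num
    rw [h16, Real.inv_rpow (by positivity), ← Real.rpow_mul (by norm_num), mul_comm,
      Real.rpow_mul (by norm_num), Real.rpow_logb (by norm_num) (by norm_num) hm0]
    norm_cast
  rw [h2] at h1
  calc (m : ℝ) * (1 / 16 : ℝ) ^ (t ^ K) ≤ m * ((m : ℝ) ^ 4)⁻¹ := by gcongr
    _ = ((m : ℝ) ^ 3)⁻¹ := by field_simp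
    _ ≤ 1 / 32 := by
        rw [one_div]
        refine inv_anti₀ (by norm_num) ?_
        calc (32 : ℝ) ≤ 33 ^ 3 := by norm_num
          _ ≤ (m : ℝ) ^ 3 := by gcongr

theorem postedPrice_qPartitioning :
    ∃ C : ℝ, 0 < C ∧
      ∀ m q : ℕ, 33 ≤ m → 4 ≤ q → q ≤ m →
        ∀ v : Finset (Fin m) → ℝ, IsValuation m v → IsQPartitioning m q v →
          ∃ p : ℝ, p ∈ Set.Icc (0 : ℝ) 1 ∧
            C * (Real.logb 2 (Real.logb 2 (q : ℝ)) / Real.logb 2 (Real.logb 2 (m : ℝ)))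
                * v Finset.univ ≤
              sSup {x : ℝ | ∃ l ∈ DeltaSet m p, x =
                sInf {y : ℝ | ∃ u ∈ DeltaSet m p, y =
                  ∑ S : Finset (Fin m), ∑ T : Finset (Fin m), l S * u T * v (S \ T)}} := by
  refine ⟨1 / 1024, by norm_num, fun m q hm hq hqm v hval hpart => ?_⟩
  by_contra! hcon
  set Lq := Real.logb 2 (q : ℝ) with hLq
  set Lm := Real.logb 2 (m : ℝ) with hLm
  have hq4 : (4 : ℝ) ≤ q := by exact_mod_cast hq
  have hLq2 : 2 ≤ Lq := by
    rw [hLq, Real.le_logb_iff_rpow_le (by norm_num) (by linarith)]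
    norm_num
    linarith
  have hLqm : Lq ≤ Lm := Real.logb_le_logb_of_le (by norm_num) (by linarith)
    (by exact_mod_cast hqm)
  have hLLq : 1 ≤ Real.logb 2 Lq := by
    rw [Real.le_logb_iff_rpow_le (by norm_num) (by linarith)]
    simpa using hLq2
  have hLLqm : Real.logb 2 Lq ≤ Real.logb 2 Lm :=
    Real.logb_le_logb_of_le (by norm_num) (by linarith) hLqm
  set a := Real.logb 2 Lm / Real.logb 2 Lq with ha
  have ha1 : 1 ≤ a := by
    rw [ha, le_div_iff₀ (by linarith)]
    linarith
  have hratio : Real.logb 2 Lq / Real.logb 2 Lm = 1 / a := by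
    rw [ha, one_div_div]
  rw [hratio] at hcon
  set c := 1 / 1024 * (1 / a) * v univ with hc
  have hreply : ∀ p : ℝ, 0 ≤ p → p ≤ 1 → ∀ l ∈ DeltaSet m p,
      ∃ u ∈ DeltaSet m p, ∑ S, ∑ T, l S * u T * v (S \ T) < c :=
    fun p hp0 hp1 l hl => hval.exists_reply hp0 (hcon p ⟨hp0, hp1⟩) hl
  have hvpos : 0 < v univ := by
    obtain ⟨l, hl, -⟩ := exists_mem_DeltaSet_le (m := m) (p := 1) (by norm_num) le_rfl hval.2.2
    obtain ⟨u, hu, hlt⟩ := hreply 1 (by norm_num) le_rfl l hl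
    have h0 : 0 ≤ ∑ S, ∑ T, l S * u T * v (S \ T) :=
      Finset.sum_nonneg fun S _ => Finset.sum_nonneg fun T _ =>
        mul_nonneg (mul_nonneg (hl.1 S) (hu.1 T)) (hval.2.2 _)
    refine (hval.2.2 univ).lt_of_ne fun h => ?_
    rw [hc, ← h, mul_zero] at hlt
    linarith
  set r := Nat.log 2 q
  set s := (r + 1) / 2
  have hr : 0 < r := Nat.log_pos (by norm_num) (by omega)
  have hrq : 2 ^ r ≤ q := Nat.pow_log_le_self 2 (by omega)
  have hqr : q < 2 ^ (r + 1) := Nat.lt_pow_succ_log_self (by norm_num) q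
  have hrs : r ≤ 2 * s := by omega
  have hs : 2 * s ≤ r + 1 := by omega
  have hK : Lm ≤ (1 + (s : ℝ) / 2) ^ (4 * ⌈a⌉₊) := by
    rw [pow_mul]
    calc Lm = Lq ^ a := by
          rw [ha, ← Real.rpow_logb (b := 2) (x := Lq) (by norm_num) (by norm_num) (by linarith),
            ← Real.rpow_mul (by norm_num), Real.rpow_logb (by norm_num) (by norm_num) (by linarith),
            mul_div_cancel₀ _ (by linarith), Real.rpow_logb (by norm_num) (by norm_num)
            (by linarith)]
      _ ≤ Lq ^ (⌈a⌉₊ : ℝ) :=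
          Real.rpow_le_rpow_of_exponent_le (by linarith) (Nat.le_ceil a)
      _ = Lq ^ ⌈a⌉₊ := Real.rpow_natCast _ _
      _ ≤ _ := pow_le_pow_left₀ (by linarith)
          (logb_le_one_add_div_two_pow_four (by omega) hqr hrs) _
  obtain ⟨l, hl, hle⟩ :=
    hpart.exists_sparse_of_value_lt hr hrq hs hrs hval.2.2 hreply (4 * ⌈a⌉₊)
  have h1 := hval.sum_le_of_mem_DeltaSet hl
  have h2 := mul_le_mul_of_nonneg_right (mul_rpow_le_of_logb_le hm hK) hvpos.le
  have h3 : (⌈a⌉₊ : ℝ) ≤ 2 * a := by linarith [(Nat.ceil_lt_add_one (by linarith : 0 ≤ a)).le]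
  have h4 : c * ⌈a⌉₊ ≤ 1 / 512 * v univ := by
    have hc0 : 0 ≤ c := by positivity
    calc c * ⌈a⌉₊ ≤ c * (2 * a) := by gcongr
      _ = 1 / 512 * v univ := by
          rw [hc]
          field_simp
          norm_num
  push_cast at hle
  linarith
end

section
/- Let v be a 1-Lipschitz q-partitioning valuation over [m] (2 ≤ q ≤ m), let S ⊆ [m] be a random set in which each element appears independently, and write Z = v(S). Then for all t ≥ 0: P[Z ≥ E[Z] + t] ≤ exp( −(1/2)·t² / ( ⌈m/q⌉·E[Z] + ((3⌈m/q⌉−1)/6)·t ) ), and for all 0 ≤ t ≤ E[Z]: P[Z ≤ E[Z] − t] ≤ exp( −(1/2)·t² / ( ⌈m/q⌉·E[Z] ) ). -/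
open Finset

open scoped Classical

/-- Probability that the random set (each `j` included independently with probability `p j`)
equals `S`. -/
noncomputable def prodWeight (m : ℕ) (p : Fin m → ℝ) (S : Finset (Fin m)) : ℝ :=
  (∏ j ∈ S, p j) * ∏ j ∈ Sᶜ, (1 - p j)

/-- `v` is 1-Lipschitz: all marginal values are at most 1. -/
def IsLipschitzVal (m : ℕ) (v : Finset (Fin m) → ℝ) : Prop :=
  ∀ (S : Finset (Fin m)) (i : Fin m), v (insert i S) - v S ≤ 1

/-! ### Self-boundedness of `q`-partitioning valuations -/

/-- The number of `i < m` in a fixed residue class modulo `q` is at most `⌈m / q⌉`. -/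
lemma card_filter_mod_le (m q : ℕ) (hq : 0 < q) (j : ℕ) :
    (univ.filter (fun i : Fin m => (i : ℕ) % q = j)).card ≤ (m + q - 1) / q := by
  rw [← Finset.card_range ((m + q - 1) / q)]
  apply Finset.card_le_card_of_injOn (fun i : Fin m => (i : ℕ) / q)
  · intro i _
    have hi := i.isLt
    have h : (i : ℕ) / q + 1 ≤ (m + q - 1) / q := by
      rw [← Nat.add_div_right _ hq]
      exact Nat.div_le_div_right (by omega)
    simpa using h
  · intro a ha b hb hab
    simp only [coe_filter, mem_univ, true_and, Set.mem_ofPred_eq] at ha hb hab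
    apply Fin.ext
    rw [← Nat.div_add_mod (a : ℕ) q, ← Nat.div_add_mod (b : ℕ) q, ha, hb, hab]

/-- Applying the partitioning inequality to the cover by complements of singletons, with equal
weights `1 / (q - 1)`. -/
lemma IsQPartitioning.sum_sub_le {m q : ℕ} (hq : 2 ≤ q) {v : Finset (Fin m) → ℝ}
    (hQ : IsQPartitioning m q v) {S : Finset (Fin m)} {P : Fin q → Finset (Fin m)}
    (hP : IsPartitionInto m q S P) :
    ∑ j, (v S - v (({j}ᶜ : Finset (Fin q)).biUnion P)) ≤ v S := by
  have hq1 : (0 : ℝ) < q - 1 := by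
    have : (2 : ℝ) ≤ q := by exact_mod_cast hq
    linarith
  have key := hQ S P hP
    (fun T => ∑ j : Fin q, if T = {j}ᶜ then ((q : ℝ) - 1)⁻¹ else 0) ?_
  · simp only [Finset.sum_mul, ite_mul, zero_mul] at key
    rw [Finset.sum_comm] at key
    simp only [Finset.sum_ite_eq', mem_univ, if_true] at key
    rw [← Finset.mul_sum, inv_mul_eq_div, le_div_iff₀ hq1] at key
    rw [Finset.sum_sub_distrib, Finset.sum_const, Finset.card_univ, Fintype.card_fin,
      nsmul_eq_mul]
    linarith
  · refine ⟨fun T => Finset.sum_nonneg fun j _ => ?_, fun i => ?_⟩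
    · split_ifs
      · exact inv_nonneg.2 hq1.le
      · exact le_rfl
    · rw [Finset.sum_comm]
      have h : ∀ j : Fin q, (∑ T ∈ univ.filter (fun T : Finset (Fin q) => i ∈ T),
          if T = {j}ᶜ then ((q : ℝ) - 1)⁻¹ else 0) =
          ((q : ℝ) - 1)⁻¹ - if j = i then ((q : ℝ) - 1)⁻¹ else 0 := by
        intro j
        rw [Finset.sum_ite_eq']
        by_cases hij : j = i
        · simp [hij]
        · simp [hij, Ne.symm hij]
      rw [Finset.sum_congr rfl fun j _ => h j, Finset.sum_sub_distrib, Finset.sum_const,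
        Finset.card_univ, Fintype.card_fin, nsmul_eq_mul, Finset.sum_ite_eq']
      simp only [mem_univ, if_true]
      apply le_of_eq
      field_simp

/-- A monotone `q`-partitioning valuation is `⌈m / q⌉`-self-bounding. -/
lemma IsQPartitioning.sum_marginals_le {m q : ℕ} (hq : 2 ≤ q) {v : Finset (Fin m) → ℝ}
    (hv : IsValuation m v) (hQ : IsQPartitioning m q v) (S : Finset (Fin m)) :
    ∑ i, (v S - v (S.erase i)) ≤ (((m + q - 1) / q : ℕ) : ℝ) * v S := by
  have hq0 : 0 < q := by omega
  let c : Fin m → Fin q := fun i => ⟨(i : ℕ) % q, Nat.mod_lt _ hq0⟩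
  let P : Fin q → Finset (Fin m) := fun j => S.filter (fun i => c i = j)
  have hP : IsPartitionInto m q S P := by
    refine ⟨fun i j hij => ?_, ?_⟩
    · rw [Finset.disjoint_left]
      intro x hx hx'
      simp only [P, mem_filter] at hx hx'
      exact hij (hx.2.symm.trans hx'.2)
    · ext x
      simp [P]
  have hsum := hQ.sum_sub_le hq hP
  set d : Fin q → ℝ := fun j => v S - v (({j}ᶜ : Finset (Fin q)).biUnion P) with hd
  have hd0 : ∀ j, 0 ≤ d j := by
    intro j
    apply sub_nonneg.2
    apply hv.2.1
    intro x hx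
    simp only [P, mem_biUnion, mem_filter] at hx
    obtain ⟨_, _, hx, _⟩ := hx
    exact hx
  have h1 : ∀ i, v S - v (S.erase i) ≤ d (c i) := by
    intro i
    apply sub_le_sub_left
    apply hv.2.1
    intro x hx
    simp only [P, mem_biUnion, mem_filter, mem_compl, mem_singleton] at hx
    obtain ⟨j, hj, hx, hxj⟩ := hx
    refine Finset.mem_erase.2 ⟨?_, hx⟩
    rintro rfl
    exact hj hxj.symm
  calc ∑ i, (v S - v (S.erase i)) ≤ ∑ i, d (c i) := Finset.sum_le_sum fun i _ => h1 i
    _ = ∑ j, ∑ i ∈ univ.filter (fun i => c i = j), d (c i) :=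
        (Finset.sum_fiberwise univ c _).symm
    _ = ∑ j, ((univ.filter (fun i => c i = j)).card : ℝ) * d j := by
        refine Finset.sum_congr rfl fun j _ => ?_
        rw [Finset.sum_congr rfl (g := fun _ => d j), Finset.sum_const, nsmul_eq_mul]
        intro i hi
        rw [(Finset.mem_filter.1 hi).2]
    _ ≤ ∑ j, (((m + q - 1) / q : ℕ) : ℝ) * d j := by
        refine Finset.sum_le_sum fun j _ => mul_le_mul_of_nonneg_right ?_ (hd0 j)
        have := card_filter_mod_le m q hq0 j
        have he : univ.filter (fun i => c i = j) =
            univ.filter (fun i : Fin m => (i : ℕ) % q = j) := by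
          ext i
          simp [c, Fin.ext_iff]
        rw [he]
        exact_mod_cast this
    _ = (((m + q - 1) / q : ℕ) : ℝ) * ∑ j, d j := by rw [Finset.mul_sum]
    _ ≤ _ := mul_le_mul_of_nonneg_left hsum (Nat.cast_nonneg _)

/-! ### Expectations under a product measure on the cube -/

/-- Expectation of `f` when each `j` is included independently with probability `p j`. -/
noncomputable def prodExp {m : ℕ} (p : Fin m → ℝ) (f : Finset (Fin m) → ℝ) : ℝ :=
  ∑ S, prodWeight m p S * f S

/-- Averaging over the coordinate `i`. -/
noncomputable def coordAvg {m : ℕ} (p : Fin m → ℝ) (i : Fin m) (f : Finset (Fin m) → ℝ) :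
    Finset (Fin m) → ℝ :=
  fun S => p i * f (insert i S) + (1 - p i) * f (S.erase i)

lemma insert_erase_eq_insert {α : Type*} [DecidableEq α] (i : α) (S : Finset α) :
    insert i (S.erase i) = insert i S := by
  ext x
  by_cases hx : x = i <;> simp [hx]

section ProductMeasure

variable {m : ℕ} {p : Fin m → ℝ}

lemma prodWeight_nonneg (hp : ∀ j, 0 ≤ p j ∧ p j ≤ 1) (S : Finset (Fin m)) :
    0 ≤ prodWeight m p S :=
  mul_nonneg (Finset.prod_nonneg fun j _ => (hp j).1)
    (Finset.prod_nonneg fun j _ => sub_nonneg.2 (hp j).2)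

lemma prodExp_const (c : ℝ) : prodExp p (fun _ => c) = c := by
  have h := Finset.prod_add p (fun j => 1 - p j) univ
  simp only [add_sub_cancel, Finset.prod_const_one, Finset.powerset_univ] at h
  rw [prodExp, ← Finset.sum_mul]
  have : ∑ S, prodWeight m p S = 1 := by
    rw [h]
    refine Finset.sum_congr rfl fun S _ => ?_
    rw [prodWeight, Finset.compl_eq_univ_sdiff]
  rw [this, one_mul]

lemma prodExp_mono (hp : ∀ j, 0 ≤ p j ∧ p j ≤ 1) {f g : Finset (Fin m) → ℝ}
    (h : ∀ S, f S ≤ g S) : prodExp p f ≤ prodExp p g :=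
  Finset.sum_le_sum fun S _ => mul_le_mul_of_nonneg_left (h S) (prodWeight_nonneg hp S)

lemma prodExp_add (f g : Finset (Fin m) → ℝ) :
    prodExp p (fun S => f S + g S) = prodExp p f + prodExp p g := by
  simp only [prodExp, mul_add, Finset.sum_add_distrib]

lemma prodExp_sub (f g : Finset (Fin m) → ℝ) :
    prodExp p (fun S => f S - g S) = prodExp p f - prodExp p g := by
  simp only [prodExp, mul_sub, Finset.sum_sub_distrib]

lemma prodExp_const_mul (c : ℝ) (f : Finset (Fin m) → ℝ) :
    prodExp p (fun S => c * f S) = c * prodExp p f := by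
  simp only [prodExp, Finset.mul_sum]
  exact Finset.sum_congr rfl fun S _ => by ring

lemma prodExp_sum {ι : Type*} (s : Finset ι) (f : ι → Finset (Fin m) → ℝ) :
    prodExp p (fun S => ∑ i ∈ s, f i S) = ∑ i ∈ s, prodExp p (f i) := by
  simp only [prodExp, Finset.mul_sum]
  exact Finset.sum_comm

lemma prodExp_pos (hp : ∀ j, 0 ≤ p j ∧ p j ≤ 1) {f : Finset (Fin m) → ℝ}
    (hf : ∀ S, 0 < f S) : 0 < prodExp p f := by
  obtain ⟨S₀, -, hS₀⟩ := Finset.exists_min_image univ f Finset.univ_nonempty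
  calc 0 < f S₀ := hf S₀
    _ = prodExp p (fun _ => f S₀) := (prodExp_const _).symm
    _ ≤ prodExp p f := prodExp_mono hp fun S => hS₀ S (mem_univ S)

lemma sum_eq_sum_notMem (i : Fin m) (f : Finset (Fin m) → ℝ) :
    ∑ S, f S = ∑ S ∈ univ.filter (fun S : Finset (Fin m) => i ∉ S), (f S + f (insert i S)) := by
  rw [Finset.sum_add_distrib,
    ← Finset.sum_filter_add_sum_filter_not univ (fun S : Finset (Fin m) => i ∉ S) f]
  congr 1
  symm
  refine Finset.sum_bij' (fun S _ => insert i S) (fun S _ => S.erase i) ?_ ?_ ?_ ?_ ?_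
  · intro S hS
    simp
  · intro S hS
    simp
  · intro S hS
    exact Finset.erase_insert (Finset.mem_filter.1 hS).2
  · intro S hS
    exact Finset.insert_erase (by simpa using hS)
  · intro S hS
    rfl

lemma prodWeight_insert {i : Fin m} {S : Finset (Fin m)} (hi : i ∉ S) :
    (1 - p i) * prodWeight m p (insert i S) = p i * prodWeight m p S := by
  have h : Sᶜ = insert i (insert i S)ᶜ := by
    ext x
    by_cases hx : x = i
    · simp [hx, hi]
    · simp [hx]
  rw [prodWeight, prodWeight, Finset.prod_insert hi, h, Finset.prod_insert (by simp)]
  ring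

lemma prodExp_coordAvg (i : Fin m) (f : Finset (Fin m) → ℝ) :
    prodExp p (coordAvg p i f) = prodExp p f := by
  rw [prodExp, prodExp, sum_eq_sum_notMem i, sum_eq_sum_notMem i]
  refine Finset.sum_congr rfl fun S hS => ?_
  have hi := (Finset.mem_filter.1 hS).2
  have h := prodWeight_insert (p := p) hi
  simp only [coordAvg, Finset.insert_idem, Finset.erase_insert hi, Finset.erase_eq_of_notMem hi]
  linear_combination (f S - f (insert i S)) * h

lemma coordAvg_pos (hp : ∀ j, 0 ≤ p j ∧ p j ≤ 1) (i : Fin m) {f : Finset (Fin m) → ℝ}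
    (hf : ∀ S, 0 < f S) (S : Finset (Fin m)) : 0 < coordAvg p i f S := by
  have h1 := hf (insert i S)
  have h2 := hf (S.erase i)
  rw [coordAvg]
  rcases (hp i).1.lt_or_eq with h | h
  · exact add_pos_of_pos_of_nonneg (mul_pos h h1) (mul_nonneg (sub_nonneg.2 (hp i).2) h2.le)
  · rw [← h]
    simpa using h2

/-- One step of the telescoping proof of the modified logarithmic Sobolev inequality. -/
lemma prodExp_mul_log_sub_log_coordAvg_le (hp : ∀ j, 0 ≤ p j ∧ p j ≤ 1) (i : Fin m)
    {g h u : Finset (Fin m) → ℝ} (hg : ∀ S, 0 < g S) (hh : ∀ S, 0 < h S) (hu : ∀ S, 0 < u S)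
    (hui : ∀ S, u (insert i S) = u (S.erase i)) :
    prodExp p (fun S => g S * (Real.log (h S) - Real.log (coordAvg p i h S))) ≤
      prodExp p (fun S => g S * (Real.log (g S) - Real.log (u S)) - g S + u S) := by
  have hT := coordAvg_pos hp i hh
  have hE : prodExp p (fun S => u S * h S / coordAvg p i h S) = prodExp p u := by
    rw [← prodExp_coordAvg i, ← prodExp_coordAvg i u]
    congr 1
    funext S
    have h1 : coordAvg p i h (insert i S) = coordAvg p i h S := by
      simp only [coordAvg, Finset.insert_idem, Finset.erase_insert_eq_erase]
    have h2 : coordAvg p i h (S.erase i) = coordAvg p i h S := by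
      simp only [coordAvg, insert_erase_eq_insert, Finset.erase_idem]
    have h3 := (hT S).ne'
    have h4 : coordAvg p i h S = p i * h (insert i S) + (1 - p i) * h (S.erase i) := rfl
    change p i * (u (insert i S) * h (insert i S) / coordAvg p i h (insert i S)) +
      (1 - p i) * (u (S.erase i) * h (S.erase i) / coordAvg p i h (S.erase i)) =
      p i * u (insert i S) + (1 - p i) * u (S.erase i)
    rw [h1, h2, hui]
    field_simp
    rw [h4]
    ring
  rw [prodExp_add, ← hE, ← prodExp_add]
  refine prodExp_mono hp fun S => ?_
  have hx : 0 < u S * h S / (g S * coordAvg p i h S) :=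
    div_pos (mul_pos (hu S) (hh S)) (mul_pos (hg S) (hT S))
  have hl := Real.log_le_sub_one_of_pos hx
  rw [Real.log_div (mul_pos (hu S) (hh S)).ne' (mul_pos (hg S) (hT S)).ne',
    Real.log_mul (hu S).ne' (hh S).ne', Real.log_mul (hg S).ne' (hT S).ne'] at hl
  have hm := mul_le_mul_of_nonneg_left hl (hg S).le
  have he : g S * (u S * h S / (g S * coordAvg p i h S) - 1) =
      u S * h S / coordAvg p i h S - g S := by
    have := (hg S).ne'
    have := (hT S).ne'
    field_simp
  rw [he] at hm
  linarith

lemma foldr_coordAvg_pos (hp : ∀ j, 0 ≤ p j ∧ p j ≤ 1) {g : Finset (Fin m) → ℝ}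
    (hg : ∀ S, 0 < g S) (l : List (Fin m)) (S : Finset (Fin m)) :
    0 < l.foldr (coordAvg p) g S := by
  induction l generalizing S with
  | nil => exact hg S
  | cons i l ih => exact coordAvg_pos hp i ih S

lemma foldr_coordAvg_insert (g : Finset (Fin m) → ℝ) (l : List (Fin m)) {i : Fin m}
    (hi : i ∈ l) (S : Finset (Fin m)) :
    l.foldr (coordAvg p) g (insert i S) = l.foldr (coordAvg p) g (S.erase i) := by
  induction l generalizing S with
  | nil => simp at hi
  | cons j l ih =>
    by_cases hij : i = j
    · subst hij
      simp [coordAvg, insert_erase_eq_insert]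
    · have hi' : i ∈ l := by simpa [hij] using hi
      have h := ih hi'
      simp only [List.foldr_cons, coordAvg]
      rw [Finset.insert_comm j i, h, Finset.erase_insert_of_ne hij,
        h, Finset.erase_insert_of_ne (Ne.symm hij), Finset.erase_right_comm]

lemma foldr_coordAvg_univ (g : Finset (Fin m) → ℝ) (S : Finset (Fin m)) :
    (univ : Finset (Fin m)).toList.foldr (coordAvg p) g S = prodExp p g := by
  set H := (univ : Finset (Fin m)).toList.foldr (coordAvg p) g with hH
  have hins : ∀ i S, H (insert i S) = H (S.erase i) := fun i S =>
    foldr_coordAvg_insert g _ (by simp) S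
  have hconst : ∀ S, H S = H ∅ := by
    intro S
    induction S using Finset.induction_on with
    | empty => rfl
    | insert i S hi ih => rw [hins, Finset.erase_eq_of_notMem hi, ih]
  have hE : ∀ l : List (Fin m), prodExp p (l.foldr (coordAvg p) g) = prodExp p g := by
    intro l
    induction l with
    | nil => rfl
    | cons i l ih => rw [List.foldr_cons, prodExp_coordAvg, ih]
  rw [← hE (univ : Finset (Fin m)).toList, ← hH, hconst S]
  conv_rhs => rw [show H = fun _ => H ∅ from funext hconst]
  rw [prodExp_const]

/-- Entropy bound on the cube (modified logarithmic Sobolev inequality): `u i` is an arbitrary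
positive function that does not depend on the coordinate `i`. -/
lemma prodExp_entropy_le (hp : ∀ j, 0 ≤ p j ∧ p j ≤ 1) {g : Finset (Fin m) → ℝ}
    {u : Fin m → Finset (Fin m) → ℝ} (hg : ∀ S, 0 < g S) (hu : ∀ i S, 0 < u i S)
    (hui : ∀ i S, u i (insert i S) = u i (S.erase i)) :
    prodExp p (fun S => g S * Real.log (g S)) - prodExp p g * Real.log (prodExp p g) ≤
      ∑ i, prodExp p (fun S => g S * (Real.log (g S) - Real.log (u i S)) - g S + u i S) := by
  have key : ∀ l : List (Fin m),
      prodExp p (fun S => g S * (Real.log (g S) - Real.log (l.foldr (coordAvg p) g S))) ≤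
      (l.map fun i =>
        prodExp p (fun S => g S * (Real.log (g S) - Real.log (u i S)) - g S + u i S)).sum := by
    intro l
    induction l with
    | nil => simp [prodExp]
    | cons i l ih =>
      rw [List.map_cons, List.sum_cons]
      refine le_trans (le_of_eq ?_) (add_le_add (prodExp_mul_log_sub_log_coordAvg_le hp i hg
        (foldr_coordAvg_pos hp hg l) (hu i) (hui i)) ih)
      rw [← prodExp_add]
      congr 1
      funext S
      rw [List.foldr_cons]
      ring
  have h := key (univ : Finset (Fin m)).toList
  rw [Finset.sum_map_toList] at h
  refine le_trans (le_of_eq ?_) h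
  simp only [foldr_coordAvg_univ, mul_sub]
  rw [prodExp_sub]
  congr 1
  rw [mul_comm, ← prodExp_const_mul]
  congr 1
  funext S
  ring

/-- Herbst-type differential inequality for the moment generating function of a self-bounding
function. -/
lemma prodExp_exp_entropy_le (hp : ∀ j, 0 ≤ p j ∧ p j ≤ 1) {v : Finset (Fin m) → ℝ} {a : ℝ}
    (h0 : ∀ S i, 0 ≤ v S - v (S.erase i)) (h1 : ∀ S i, v S - v (S.erase i) ≤ 1)
    (ha : ∀ S, ∑ i, (v S - v (S.erase i)) ≤ a * v S) (l : ℝ) :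
    l * prodExp p (fun S => v S * Real.exp (l * v S)) -
        prodExp p (fun S => Real.exp (l * v S)) *
          Real.log (prodExp p (fun S => Real.exp (l * v S))) ≤
      (Real.exp (-l) + l - 1) * (a * prodExp p (fun S => v S * Real.exp (l * v S))) := by
  have h := prodExp_entropy_le hp (g := fun S => Real.exp (l * v S))
    (u := fun i S => Real.exp (l * v (S.erase i))) (fun S => Real.exp_pos _)
    (fun i S => Real.exp_pos _) (fun i S => by simp)
  simp only [Real.log_exp] at h
  have e1 : prodExp p (fun S => Real.exp (l * v S) * (l * v S)) =
      l * prodExp p (fun S => v S * Real.exp (l * v S)) := by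
    rw [← prodExp_const_mul]
    congr 1
    funext S
    ring
  rw [e1] at h
  refine h.trans ?_
  rw [← prodExp_sum, ← prodExp_const_mul, ← prodExp_const_mul]
  refine prodExp_mono hp fun S => ?_
  have hψ : 0 ≤ Real.exp (-l) + l - 1 := by linarith [Real.add_one_le_exp (-l)]
  have hterm : ∀ i, Real.exp (l * v S) * (l * v S - l * v (S.erase i)) - Real.exp (l * v S) +
      Real.exp (l * v (S.erase i)) ≤
      Real.exp (l * v S) * ((Real.exp (-l) + l - 1) * (v S - v (S.erase i))) := by
    intro i
    set y := v S - v (S.erase i) with hy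
    have he : Real.exp (l * v (S.erase i)) = Real.exp (l * v S) * Real.exp (y * -l) := by
      rw [← Real.exp_add]
      congr 1
      rw [hy]
      ring
    have hc := convexOn_exp.2 (Set.mem_univ (-l)) (Set.mem_univ 0) (h0 S i)
      (sub_nonneg.2 (h1 S i)) (add_sub_cancel _ _)
    simp only [smul_eq_mul, mul_zero, add_zero, Real.exp_zero, mul_one] at hc
    rw [he]
    have := mul_le_mul_of_nonneg_left hc (Real.exp_pos (l * v S)).le
    rw [← mul_sub, ← hy] at *
    nlinarith [this]
  refine (Finset.sum_le_sum fun i _ => hterm i).trans ?_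
  rw [← Finset.mul_sum, ← Finset.mul_sum]
  have := mul_le_mul_of_nonneg_left (mul_le_mul_of_nonneg_left (ha S) hψ)
    (Real.exp_pos (l * v S)).le
  linarith

lemma hasDerivAt_prodExp_exp (v : Finset (Fin m) → ℝ) (l : ℝ) :
    HasDerivAt (fun x => prodExp p (fun S => Real.exp (x * v S)))
      (prodExp p (fun S => v S * Real.exp (l * v S))) l := by
  unfold prodExp
  apply HasDerivAt.fun_sum
  intro S _
  have h := (((hasDerivAt_id l).mul_const (v S)).exp).const_mul (prodWeight m p S)
  refine h.congr_deriv ?_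
  simp only [id]
  ring

end ProductMeasure

/-! ### Differential inequalities -/

lemma exp_neg_add_sub_one_mul_le (x : ℝ) :
    (Real.exp (-x) + x - 1) * (1 + x / 3) ≤ x ^ 2 / 2 := by
  let h : ℝ → ℝ := fun x => x ^ 2 / 2 - (Real.exp (-x) + x - 1) * (1 + x / 3)
  let h' : ℝ → ℝ := fun x => x - (1 - Real.exp (-x)) * (1 + x / 3) -
    (Real.exp (-x) + x - 1) / 3
  have hexp : ∀ x : ℝ, HasDerivAt (fun x => Real.exp (-x)) (-Real.exp (-x)) x := by
    intro x
    simpa using (hasDerivAt_neg x).exp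
  have d1 : ∀ x, HasDerivAt h (h' x) x := by
    intro x
    have := (((hasDerivAt_id x).pow 2).div_const 2).sub
      ((((hexp x).add (hasDerivAt_id x)).sub_const 1).mul
        (((hasDerivAt_id x).div_const 3).const_add 1))
    refine this.congr_deriv ?_
    simp [h']
    ring
  have d2 : ∀ x, HasDerivAt h' (1 / 3 - Real.exp (-x) * (1 + x) / 3) x := by
    intro x
    have := ((hasDerivAt_id x).sub (((hexp x).const_sub 1).mul
        (((hasDerivAt_id x).div_const 3).const_add 1))).sub
      ((((hexp x).add (hasDerivAt_id x)).sub_const 1).div_const 3)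
    refine this.congr_deriv ?_
    simp
    ring
  have hmono : Monotone h' := by
    apply monotone_of_deriv_nonneg (fun x => (d2 x).differentiableAt)
    intro x
    rw [(d2 x).deriv]
    have h1 := Real.add_one_le_exp x
    have h2 := mul_le_mul_of_nonneg_left h1 (Real.exp_pos (-x)).le
    rw [← Real.exp_add, neg_add_cancel, Real.exp_zero] at h2
    linarith
  have h'0 : h' 0 = 0 := by simp [h']
  have h0 : h 0 = 0 := by simp [h]
  suffices 0 ≤ h x by
    simp only [h] at this
    linarith
  have hcont : Continuous h := continuous_iff_continuousAt.2 fun x => (d1 x).continuousAt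
  rw [← h0]
  rcases le_total 0 x with hx | hx
  · refine monotoneOn_of_deriv_nonneg (convex_Ici 0) hcont.continuousOn
      (fun y _ => (d1 y).differentiableAt.differentiableWithinAt) ?_
      (Set.self_mem_Ici) hx hx
    intro y hy
    rw [interior_Ici] at hy
    rw [(d1 y).deriv, ← h'0]
    exact hmono (le_of_lt hy)
  · refine antitoneOn_of_deriv_nonpos (convex_Iic 0) hcont.continuousOn
      (fun y _ => (d1 y).differentiableAt.differentiableWithinAt) ?_
      hx (Set.self_mem_Iic) hx
    intro y hy
    rw [interior_Iic] at hy
    rw [(d1 y).deriv, ← h'0]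
    exact hmono (le_of_lt hy)

/-- If `F / f` is antitone on `(0, b]`, `F = o(x)` and `f ~ x` at `0`, then `F b ≤ 0`. -/
lemma nonpos_of_deriv_mul_sub_nonpos {F F' f f' : ℝ → ℝ} {b : ℝ} (hb : 0 < b)
    (hF0 : F 0 = 0) (hf0 : f 0 = 0) (hF'0 : HasDerivAt F 0 0) (hf'0 : HasDerivAt f 1 0)
    (hF : ∀ x, 0 < x → x ≤ b → HasDerivAt F (F' x) x)
    (hf : ∀ x, 0 < x → x ≤ b → HasDerivAt f (f' x) x)
    (hpos : ∀ x, 0 < x → x ≤ b → 0 < f x)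
    (hle : ∀ x, 0 < x → x < b → F' x * f x - F x * f' x ≤ 0) : F b ≤ 0 := by
  have hd : ∀ x, 0 < x → x ≤ b →
      HasDerivAt (fun y => F y / f y) ((F' x * f x - F x * f' x) / f x ^ 2) x :=
    fun x hx hxb => (hF x hx hxb).div (hf x hx hxb) (hpos x hx hxb).ne'
  have hanti : AntitoneOn (fun y => F y / f y) (Set.Ioc 0 b) := by
    apply antitoneOn_of_deriv_nonpos (convex_Ioc 0 b)
    · exact fun x hx => (hd x hx.1 hx.2).continuousAt.continuousWithinAt
    · intro x hx
      rw [interior_Ioc] at hx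
      exact (hd x hx.1 hx.2.le).differentiableAt.differentiableWithinAt
    · intro x hx
      rw [interior_Ioc] at hx
      rw [(hd x hx.1 hx.2.le).deriv]
      exact div_nonpos_of_nonpos_of_nonneg (hle x hx.1 hx.2) (sq_nonneg _)
  have hlim : Filter.Tendsto (fun y => F y / f y) (nhdsWithin 0 (Set.Ioi 0)) (nhds 0) := by
    have h1 := hasDerivAt_iff_tendsto_slope.1 hF'0
    have h2 := hasDerivAt_iff_tendsto_slope.1 hf'0
    have h3 := (h1.div h2 one_ne_zero).mono_left
      (nhdsWithin_mono (0 : ℝ) (fun x (hx : x ∈ Set.Ioi (0 : ℝ)) => (ne_of_gt hx : x ≠ 0)))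
    rw [zero_div] at h3
    refine h3.congr' ?_
    filter_upwards [self_mem_nhdsWithin] with x hx
    have hx' : x ≠ 0 := ne_of_gt hx
    simp only [Pi.div_apply, slope_def_field, hF0, hf0, sub_zero]
    exact div_div_div_cancel_right₀ hx' _ _
  have hq : F b / f b ≤ 0 := by
    apply ge_of_tendsto hlim
    filter_upwards [Ioo_mem_nhdsGT hb] with x hx
    exact hanti ⟨hx.1, hx.2.le⟩ ⟨hb, le_rfl⟩ hx.2.le
  by_contra hcon
  exact absurd hq (not_le.2 (div_pos (not_le.1 hcon) (hpos b hb le_rfl)))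

section Comparison

variable {G G' : ℝ → ℝ} {a w : ℝ}

/-- Comparison of a solution of the Herbst inequality with the sub-gamma function
`x ^ 2 / (2 * (1 - c * x))`, `c = (3 * a - 1) / 6`, on the positive side. -/
lemma le_subGamma_of_herbst (ha : 1 ≤ a) (hG : ∀ x, HasDerivAt G (G' x) x) (hG0 : G 0 = 0)
    (hG'0 : G' 0 = 0) (hpos : ∀ x, 0 ≤ a * G' x + w)
    (hH : ∀ x, x * G' x - G x ≤ (Real.exp (-x) + x - 1) * (a * G' x + w))
    {b : ℝ} (hb : 0 < b) (hcb : (3 * a - 1) / 6 * b < 1) :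
    G b ≤ w * (b ^ 2 / (2 * (1 - (3 * a - 1) / 6 * b))) := by
  set c := (3 * a - 1) / 6 with hc
  have hc0 : 0 < c := by rw [hc]; linarith
  let K : ℝ → ℝ := fun x => x ^ 2 / (2 * (1 - c * x))
  let K' : ℝ → ℝ := fun x => (2 * x - c * x ^ 2) / (2 * (1 - c * x) ^ 2)
  have hK : ∀ x, c * x < 1 → HasDerivAt K (K' x) x := by
    intro x hx
    have hne : 1 - c * x ≠ 0 := by linarith
    have h := ((hasDerivAt_id x).pow 2).div
      ((((hasDerivAt_id x).const_mul c).const_sub 1).const_mul 2) (mul_ne_zero two_ne_zero hne)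
    refine h.congr_deriv ?_
    simp only [K', id, Pi.pow_apply]
    field_simp
    ring
  have hcx : ∀ x, x ≤ b → c * x < 1 := fun x hx =>
    (mul_le_mul_of_nonneg_left hx hc0.le).trans_lt hcb
  have key : G b - w * K b ≤ 0 := by
    apply nonpos_of_deriv_mul_sub_nonpos (F := fun x => G x - w * K x)
      (F' := fun x => G' x - w * K' x) (f := fun x => x + a * K x)
      (f' := fun x => 1 + a * K' x) hb
    · simp [K, hG0]
    · simp [K]
    · have h := (hG 0).sub ((hK 0 (by simp)).const_mul w)
      refine h.congr_deriv ?_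
      simp [hG'0, K']
    · have h := (hasDerivAt_id (0 : ℝ)).add ((hK 0 (by simp)).const_mul a)
      refine h.congr_deriv ?_
      simp [K']
    · exact fun x _ hx => (hG x).sub ((hK x (hcx x hx)).const_mul w)
    · exact fun x _ hx => (hasDerivAt_id x).add ((hK x (hcx x hx)).const_mul a)
    · intro x hx hxb
      have h1 := hcx x hxb
      have : 0 ≤ K x := div_nonneg (sq_nonneg _) (by linarith)
      have : 0 ≤ a * K x := mul_nonneg (by linarith) this
      linarith
    · intro x hx hxb
      have h1 : 0 < 1 - c * x := by linarith [hcx x hxb.le]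
      have e1 : x * K' x - K x = x ^ 2 / (2 * (1 - c * x) ^ 2) := by
        simp only [K, K']
        field_simp
        ring
      have e2 : 1 + a * K' x = (2 + 2 / 3 * x - c / 3 * x ^ 2) / (2 * (1 - c * x) ^ 2) := by
        have haa : a = 2 * c + 1 / 3 := by rw [hc]; ring
        simp only [K']
        rw [haa]
        field_simp
        ring
      have h2 : (Real.exp (-x) + x - 1) * (1 + a * K' x) ≤ x * K' x - K x := by
        rw [e1, e2, ← mul_div_assoc]
        apply div_le_div_of_nonneg_right _ (by positivity)
        have h3 := exp_neg_add_sub_one_mul_le x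
        have h4 : 0 ≤ Real.exp (-x) + x - 1 := by linarith [Real.add_one_le_exp (-x)]
        have h5 := mul_nonneg h4 (mul_nonneg hc0.le (sq_nonneg x))
        nlinarith
      have h3 : 0 ≤ 1 + a * K' x := by
        have : 0 ≤ K' x := by
          apply div_nonneg _ (by positivity)
          nlinarith
        have : 0 ≤ a * K' x := mul_nonneg (by linarith) this
        linarith
      have h4 := mul_le_mul_of_nonneg_left (hH x) h3
      have h5 := mul_le_mul_of_nonneg_right h2 (hpos x)
      change (G' x - w * K' x) * (x + a * K x) - (G x - w * K x) * (1 + a * K' x) ≤ 0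
      nlinarith
  linarith

/-- Comparison of a solution of the Herbst inequality with `x ^ 2 / 2` on the negative side. -/
lemma le_subGaussian_of_herbst (ha : 1 ≤ a) (hG : ∀ x, HasDerivAt G (G' x) x) (hG0 : G 0 = 0)
    (hG'0 : G' 0 = 0) (hpos : ∀ x, 0 ≤ a * G' x + w)
    (hH : ∀ x, x * G' x - G x ≤ (Real.exp (-x) + x - 1) * (a * G' x + w))
    {b : ℝ} (hb : 0 < b) (hab : a * b ≤ 1) :
    G (-b) ≤ w * (b ^ 2 / 2) := by
  have hGn : ∀ x, HasDerivAt (fun y => G (-y)) (-G' (-x)) x := by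
    intro x
    have h := (hG (-x)).comp x (hasDerivAt_neg x)
    refine h.congr_deriv ?_
    ring
  have hK : ∀ x : ℝ, HasDerivAt (fun y : ℝ => y ^ 2 / 2) x x := by
    intro x
    have h := (hasDerivAt_pow 2 x).div_const 2
    refine h.congr_deriv ?_
    simp
  have key : G (-b) - w * (b ^ 2 / 2) ≤ 0 := by
    apply nonpos_of_deriv_mul_sub_nonpos (F := fun x => G (-x) - w * (x ^ 2 / 2))
      (F' := fun x => -G' (-x) - w * x) (f := fun x => x - a * (x ^ 2 / 2))
      (f' := fun x => 1 - a * x) hb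
    · simp [hG0]
    · simp
    · have h := (hGn 0).sub ((hK 0).const_mul w)
      refine h.congr_deriv ?_
      simp [hG'0]
    · have h := (hasDerivAt_id (0 : ℝ)).sub ((hK 0).const_mul a)
      refine h.congr_deriv ?_
      simp
    · exact fun x _ _ => (hGn x).sub ((hK x).const_mul w)
    · exact fun x _ _ => (hasDerivAt_id x).sub ((hK x).const_mul a)
    · intro x hx hxb
      have : a * x ≤ 1 := (mul_le_mul_of_nonneg_left hxb (by linarith)).trans hab
      nlinarith
    · intro x hx hxb
      have hax : a * x ≤ 1 := (mul_le_mul_of_nonneg_left hxb.le (by linarith)).trans hab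
      have h1 := exp_neg_add_sub_one_mul_le (-x)
      have h4 : 0 ≤ Real.exp (- -x) + -x - 1 := by linarith [Real.add_one_le_exp (- -x)]
      have h2 : (Real.exp (- -x) + -x - 1) * (1 - a * x) ≤ x ^ 2 / 2 := by
        refine le_trans (mul_le_mul_of_nonneg_left ?_ h4) (h1.trans (by rw [neg_sq]))
        nlinarith
      have h3 := mul_le_mul_of_nonneg_left (hH (-x)) (sub_nonneg.2 hax)
      have h5 := mul_le_mul_of_nonneg_right h2 (hpos (-x))
      change (-G' (-x) - w * x) * (x - a * (x ^ 2 / 2)) -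
        (G (-x) - w * (x ^ 2 / 2)) * (1 - a * x) ≤ 0
      nlinarith
  linarith

end Comparison

/-! ### Concentration of self-bounding functions -/

/-- Chernoff's bound under the product measure. -/
lemma sum_prodWeight_filter_le {m : ℕ} {p : Fin m → ℝ} (hp : ∀ j, 0 ≤ p j ∧ p j ≤ 1)
    (A : Finset (Fin m) → Prop) [DecidablePred A] {f : Finset (Fin m) → ℝ} (hf : ∀ S, 0 ≤ f S)
    (hA : ∀ S, A S → 1 ≤ f S) :
    ∑ S ∈ univ.filter A, prodWeight m p S ≤ prodExp p f := by
  rw [Finset.sum_filter]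
  refine Finset.sum_le_sum fun S _ => ?_
  split_ifs with h
  · exact le_mul_of_one_le_right (prodWeight_nonneg hp S) (hA S h)
  · exact mul_nonneg (prodWeight_nonneg hp S) (hf S)

/-- Bounds on the centred logarithmic moment generating function of an `a`-self-bounding
function with `1 ≤ a`. -/
lemma log_prodExp_exp_le {m : ℕ} {p : Fin m → ℝ} (hp : ∀ j, 0 ≤ p j ∧ p j ≤ 1)
    {v : Finset (Fin m) → ℝ} {a : ℝ} (ha1 : 1 ≤ a) (hv : ∀ S, 0 ≤ v S)
    (h0 : ∀ S i, 0 ≤ v S - v (S.erase i)) (h1 : ∀ S i, v S - v (S.erase i) ≤ 1)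
    (ha : ∀ S, ∑ i, (v S - v (S.erase i)) ≤ a * v S) :
    (∀ b, 0 < b → (3 * a - 1) / 6 * b < 1 →
      Real.log (prodExp p fun S => Real.exp (b * v S)) - b * prodExp p v ≤
        a * prodExp p v * (b ^ 2 / (2 * (1 - (3 * a - 1) / 6 * b)))) ∧
    (∀ b, 0 < b → a * b ≤ 1 →
      Real.log (prodExp p fun S => Real.exp (-b * v S)) - -b * prodExp p v ≤
        a * prodExp p v * (b ^ 2 / 2)) := by
  set M : ℝ → ℝ := fun x => prodExp p fun S => Real.exp (x * v S) with hM
  set M' : ℝ → ℝ := fun x => prodExp p fun S => v S * Real.exp (x * v S) with hM'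
  have hMpos : ∀ x, 0 < M x := fun x => prodExp_pos hp fun S => Real.exp_pos _
  have hM'nonneg : ∀ x, 0 ≤ M' x := fun x => by
    rw [← prodExp_const (p := p) 0]
    exact prodExp_mono hp fun S => mul_nonneg (hv S) (Real.exp_pos _).le
  have hG : ∀ x, HasDerivAt (fun x => Real.log (M x) - x * prodExp p v)
      (M' x / M x - prodExp p v) x := by
    intro x
    have h := ((hasDerivAt_prodExp_exp v x).log (hMpos x).ne').sub
      ((hasDerivAt_id x).mul_const (prodExp p v))
    refine h.congr_deriv ?_
    simp [hM, hM']
  have hM0 : M 0 = 1 := by simp [hM, prodExp_const]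
  have hM'0 : M' 0 = prodExp p v := by simp [hM']
  have hG0 : Real.log (M 0) - 0 * prodExp p v = 0 := by simp [hM0]
  have hG'0 : M' 0 / M 0 - prodExp p v = 0 := by simp [hM0, hM'0]
  have hid : ∀ x, a * (M' x / M x - prodExp p v) + a * prodExp p v = a * M' x / M x :=
    fun x => by ring
  have hpos : ∀ x, 0 ≤ a * (M' x / M x - prodExp p v) + a * prodExp p v := fun x => by
    rw [hid]
    exact div_nonneg (mul_nonneg (by linarith) (hM'nonneg x)) (hMpos x).le
  have hH : ∀ x, x * (M' x / M x - prodExp p v) - (Real.log (M x) - x * prodExp p v) ≤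
      (Real.exp (-x) + x - 1) * (a * (M' x / M x - prodExp p v) + a * prodExp p v) := by
    intro x
    have h : x * M' x - M x * Real.log (M x) ≤ (Real.exp (-x) + x - 1) * (a * M' x) :=
      prodExp_exp_entropy_le hp h0 h1 ha x
    have hne := (hMpos x).ne'
    have h2 := div_le_div_of_nonneg_right h (hMpos x).le
    rw [hid]
    calc _ = (x * M' x - M x * Real.log (M x)) / M x := by field_simp; ring
      _ ≤ _ := h2
      _ = _ := by ring
  exact ⟨fun b hb hcb => le_subGamma_of_herbst ha1 hG hG0 hG'0 hpos hH hb hcb,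
    fun b hb hab => le_subGaussian_of_herbst ha1 hG hG0 hG'0 hpos hH hb hab⟩

lemma prodExp_exp_sub_eq {m : ℕ} {p : Fin m → ℝ} (hp : ∀ j, 0 ≤ p j ∧ p j ≤ 1)
    (v : Finset (Fin m) → ℝ) (l r : ℝ) :
    prodExp p (fun S => Real.exp (l * (v S - r))) =
      Real.exp (Real.log (prodExp p fun S => Real.exp (l * v S)) - l * r) := by
  rw [sub_eq_add_neg, Real.exp_add, Real.exp_log (prodExp_pos hp fun S => Real.exp_pos _),
    mul_comm, ← prodExp_const_mul]
  congr 1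
  funext S
  rw [← Real.exp_add]
  congr 1
  ring

/-- Upper tail of an `a`-self-bounding function. -/
lemma selfBounding_upper_tail {m : ℕ} {p : Fin m → ℝ} (hp : ∀ j, 0 ≤ p j ∧ p j ≤ 1)
    {v : Finset (Fin m) → ℝ} {a : ℝ} (ha1 : 1 ≤ a) (hv : ∀ S, 0 ≤ v S)
    (h0 : ∀ S i, 0 ≤ v S - v (S.erase i)) (h1 : ∀ S i, v S - v (S.erase i) ≤ 1)
    (ha : ∀ S, ∑ i, (v S - v (S.erase i)) ≤ a * v S) {t : ℝ} (ht : 0 ≤ t) :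
    ∑ S ∈ univ.filter (fun S => prodExp p v + t ≤ v S), prodWeight m p S ≤
      Real.exp (-(1 / 2) * (t ^ 2 / (a * prodExp p v + (3 * a - 1) / 6 * t))) := by
  rcases ht.eq_or_lt with rfl | ht
  · refine (sum_prodWeight_filter_le hp _ (f := fun _ => 1) (fun _ => zero_le_one)
      fun _ _ => le_rfl).trans ?_
    rw [prodExp_const]
    simp
  set EZ := prodExp p v with hEZ
  have hE : 0 ≤ EZ := by
    rw [← prodExp_const (p := p) 0]
    exact prodExp_mono hp hv
  rcases hE.eq_or_lt with hE0 | hE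
  · refine (sum_prodWeight_filter_le hp _ (f := fun S => t⁻¹ * v S)
      (fun S => mul_nonneg (inv_nonneg.2 ht.le) (hv S)) fun S hS => ?_).trans ?_
    · rw [inv_mul_eq_div, one_le_div ht]
      linarith
    · rw [prodExp_const_mul, ← hEZ, ← hE0, mul_zero]
      exact (Real.exp_pos _).le
  set c := (3 * a - 1) / 6 with hc
  have hc0 : 0 < c := by rw [hc]; linarith
  have haE : 0 < a * EZ := mul_pos (by linarith) hE
  have hden : 0 < a * EZ + c * t := add_pos haE (mul_pos hc0 ht)
  set b := t / (a * EZ + c * t) with hb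
  have hb0 : 0 < b := div_pos ht hden
  have hcb : 1 - c * b = a * EZ / (a * EZ + c * t) := by
    rw [hb]
    field_simp
    ring
  have hcb1 : c * b < 1 := by
    have := div_pos haE hden
    linarith
  have hG := (log_prodExp_exp_le hp ha1 hv h0 h1 ha).1 b hb0 hcb1
  refine (sum_prodWeight_filter_le hp _ (f := fun S => Real.exp (b * (v S - (EZ + t))))
    (fun S => (Real.exp_pos _).le) fun S hS => ?_).trans ?_
  · exact Real.one_le_exp (mul_nonneg hb0.le (sub_nonneg.2 hS))
  · rw [prodExp_exp_sub_eq hp]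
    apply Real.exp_le_exp.2
    have e : a * EZ * (b ^ 2 / (2 * (1 - c * b))) - b * t =
        -(1 / 2) * (t ^ 2 / (a * EZ + c * t)) := by
      rw [hcb, hb]
      field_simp
      ring
    rw [← e]
    linarith

/-- Lower tail of an `a`-self-bounding function. -/
lemma selfBounding_lower_tail {m : ℕ} {p : Fin m → ℝ} (hp : ∀ j, 0 ≤ p j ∧ p j ≤ 1)
    {v : Finset (Fin m) → ℝ} {a : ℝ} (ha1 : 1 ≤ a) (hv : ∀ S, 0 ≤ v S)
    (h0 : ∀ S i, 0 ≤ v S - v (S.erase i)) (h1 : ∀ S i, v S - v (S.erase i) ≤ 1)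
    (ha : ∀ S, ∑ i, (v S - v (S.erase i)) ≤ a * v S) {t : ℝ} (ht : 0 ≤ t)
    (htE : t ≤ prodExp p v) :
    ∑ S ∈ univ.filter (fun S => v S ≤ prodExp p v - t), prodWeight m p S ≤
      Real.exp (-(1 / 2) * (t ^ 2 / (a * prodExp p v))) := by
  rcases ht.eq_or_lt with rfl | ht
  · refine (sum_prodWeight_filter_le hp _ (f := fun _ => 1) (fun _ => zero_le_one)
      fun _ _ => le_rfl).trans ?_
    rw [prodExp_const]
    simp
  set EZ := prodExp p v with hEZ
  have hE : 0 < EZ := ht.trans_le htE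
  have ha0 : 0 < a := by linarith
  have haE : 0 < a * EZ := mul_pos ha0 hE
  set b := t / (a * EZ) with hb
  have hb0 : 0 < b := div_pos ht haE
  have hab : a * b ≤ 1 := by
    have : a * b = t / EZ := by
      rw [hb]
      field_simp
    rw [this]
    exact (div_le_one hE).2 htE
  have hG := (log_prodExp_exp_le hp ha1 hv h0 h1 ha).2 b hb0 hab
  refine (sum_prodWeight_filter_le hp _ (f := fun S => Real.exp (-b * (v S - (EZ - t))))
    (fun S => (Real.exp_pos _).le) fun S hS => ?_).trans ?_
  · apply Real.one_le_exp
    nlinarith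
  · rw [prodExp_exp_sub_eq hp]
    apply Real.exp_le_exp.2
    have e : a * EZ * (b ^ 2 / 2) - b * t = -(1 / 2) * (t ^ 2 / (a * EZ)) := by
      rw [hb]
      field_simp
      ring
    rw [← e]
    linarith

theorem qPartitioning_selfBounding_concentration (m q : ℕ) (hq : 2 ≤ q) (hqm : q ≤ m)
    (v : Finset (Fin m) → ℝ) (hv : IsValuation m v)
    (hQ : IsQPartitioning m q v) (hLip : IsLipschitzVal m v)
    (p : Fin m → ℝ) (hp : ∀ j, 0 ≤ p j ∧ p j ≤ 1)
    (EZ : ℝ) (hEZ : EZ = ∑ S : Finset (Fin m), prodWeight m p S * v S)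
    (k : ℝ) (hk : k = ((m + q - 1) / q : ℕ)) :
    (∀ t : ℝ, 0 ≤ t →
      ∑ S ∈ Finset.univ.filter (fun S : Finset (Fin m) => EZ + t ≤ v S), prodWeight m p S ≤
        Real.exp (-(1 / 2) * (t ^ 2 / (k * EZ + (3 * k - 1) / 6 * t)))) ∧
    (∀ t : ℝ, 0 ≤ t → t ≤ EZ →
      ∑ S ∈ Finset.univ.filter (fun S : Finset (Fin m) => v S ≤ EZ - t), prodWeight m p S ≤
        Real.exp (-(1 / 2) * (t ^ 2 / (k * EZ)))) := by
  have hq0 : 0 < q := by omega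
  have hk1 : 1 ≤ k := by
    rw [hk, Nat.one_le_cast, Nat.one_le_div_iff hq0]
    omega
  have h0 : ∀ S i, 0 ≤ v S - v (S.erase i) := fun S i =>
    sub_nonneg.2 (hv.2.1 _ _ (Finset.erase_subset i S))
  have h1 : ∀ S i, v S - v (S.erase i) ≤ 1 := by
    intro S i
    by_cases hi : i ∈ S
    · have h := hLip (S.erase i) i
      rwa [Finset.insert_erase hi] at h
    · rw [Finset.erase_eq_of_notMem hi, sub_self]
      exact zero_le_one
  have ha : ∀ S, ∑ i, (v S - v (S.erase i)) ≤ k * v S := fun S => by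
    rw [hk]
    exact hQ.sum_marginals_le hq hv S
  have hE : EZ = prodExp p v := hEZ
  subst hE
  exact ⟨fun t ht => selfBounding_upper_tail hp hk1 hv.2.2 h0 h1 ha ht,
    fun t ht htE => selfBounding_lower_tail hp hk1 hv.2.2 h0 h1 ha ht htE⟩
end

section
/- Let v be a 1-Lipschitz q-partitioning valuation over [m], and let S ⊆ [m] be a random set in which each element appears independently. Then for any real numbers a ≥ 0 and k ≥ 0 with P[v(S) ≤ a] ≥ 1/2 (in particular for a equal to a median of v(S)), and any integers 1 ≤ s < r ≤ log₂ q: P[ v(S) ≥ (r/s)·a + k ] ≤ (r/s)^{−k} · 2^{r/s}. -/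
open Finset

open scoped Classical

/-- The probability that the random subset of `U` containing each `j ∈ U` independently with
probability `p j` equals `x`. -/
noncomputable def subsetWeight {ι : Type*} [DecidableEq ι] (p : ι → ℝ) (U x : Finset ι) : ℝ :=
  (∏ j ∈ x, p j) * ∏ j ∈ U \ x, (1 - p j)

/-- The expectation of `F` over the random subset of `U` with inclusion probabilities `p`. -/
noncomputable def subsetExp {ι : Type*} [DecidableEq ι] (p : ι → ℝ) (U : Finset ι)
    (F : Finset ι → ℝ) : ℝ :=
  ∑ x ∈ U.powerset, subsetWeight p U x * F x

/-- The probability that the random subset of `U` lies in `A`. -/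
noncomputable def subsetProb {ι : Type*} [DecidableEq ι] (p : ι → ℝ) (U : Finset ι)
    (A : Set (Finset ι)) : ℝ :=
  subsetExp p U (A.indicator 1)

/-- Some choice of `y i ∈ A i` covers all but at most `l` elements of `x` at least `s` times. -/
def CoversUpTo {ι : Type*} [DecidableEq ι] {r : ℕ} (s : ℕ) (A : Fin r → Set (Finset ι))
    (x : Finset ι) (l : ℕ) : Prop :=
  ∃ y : Fin r → Finset ι, (∀ i, y i ∈ A i) ∧
    #{j ∈ x | #{i | j ∈ y i} < s} ≤ l

section SubsetExp

variable {ι : Type*} [DecidableEq ι] {p : ι → ℝ}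

lemma subsetWeight_nonneg (hp : ∀ j, 0 ≤ p j ∧ p j ≤ 1) (U x : Finset ι) :
    0 ≤ subsetWeight p U x :=
  mul_nonneg (prod_nonneg fun j _ => (hp j).1)
    (prod_nonneg fun j _ => sub_nonneg.2 (hp j).2)

lemma subsetExp_mono (hp : ∀ j, 0 ≤ p j ∧ p j ≤ 1) (U : Finset ι) {F G : Finset ι → ℝ}
    (h : ∀ x, F x ≤ G x) : subsetExp p U F ≤ subsetExp p U G :=
  sum_le_sum fun x _ => mul_le_mul_of_nonneg_left (h x) (subsetWeight_nonneg hp U x)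

lemma subsetExp_nonneg (hp : ∀ j, 0 ≤ p j ∧ p j ≤ 1) (U : Finset ι) {F : Finset ι → ℝ}
    (h : ∀ x, 0 ≤ F x) : 0 ≤ subsetExp p U F :=
  sum_nonneg fun x _ => mul_nonneg (subsetWeight_nonneg hp U x) (h x)

lemma subsetExp_const_mul (U : Finset ι) (c : ℝ) (F : Finset ι → ℝ) :
    subsetExp p U (fun x => c * F x) = c * subsetExp p U F := by
  simp only [subsetExp, mul_sum]
  exact sum_congr rfl fun x _ => by ring

lemma subsetExp_congr {U : Finset ι} {F G : Finset ι → ℝ} (h : ∀ x ⊆ U, F x = G x) :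
    subsetExp p U F = subsetExp p U G :=
  sum_congr rfl fun x hx => by rw [h x (mem_powerset.1 hx)]

lemma subsetExp_insert {a : ι} {U : Finset ι} (ha : a ∉ U) (F : Finset ι → ℝ) :
    subsetExp p (insert a U) F =
      (1 - p a) * subsetExp p U F + p a * subsetExp p U (fun x => F (insert a x)) := by
  simp only [subsetExp, mul_sum]
  rw [sum_powerset_insert ha]
  congr 1
  · refine sum_congr rfl fun x hx => ?_
    have hax : a ∉ x := fun h => ha (mem_powerset.1 hx h)
    rw [subsetWeight, subsetWeight, insert_sdiff_of_notMem _ hax,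
      prod_insert (fun h => ha (mem_sdiff.1 h).1)]
    ring
  · refine sum_congr rfl fun x hx => ?_
    have hax : a ∉ x := fun h => ha (mem_powerset.1 hx h)
    have hU : insert a U \ insert a x = U \ x := by
      ext j
      simp only [mem_sdiff, mem_insert]
      grind
    rw [subsetWeight, subsetWeight, hU, prod_insert hax]
    ring

lemma subsetProb_nonneg (hp : ∀ j, 0 ≤ p j ∧ p j ≤ 1) (U : Finset ι) (A : Set (Finset ι)) :
    0 ≤ subsetProb p U A :=
  subsetExp_nonneg hp U fun x => Set.indicator_nonneg (fun _ _ => zero_le_one) x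

lemma subsetProb_mono (hp : ∀ j, 0 ≤ p j ∧ p j ≤ 1) (U : Finset ι) {A B : Set (Finset ι)}
    (h : A ⊆ B) : subsetProb p U A ≤ subsetProb p U B :=
  subsetExp_mono hp U (Set.indicator_le_indicator_of_subset h fun _ => zero_le_one)

lemma subsetProb_insert {a : ι} {U : Finset ι} (ha : a ∉ U) (A : Set (Finset ι)) :
    subsetProb p (insert a U) A =
      (1 - p a) * subsetProb p U A + p a * subsetProb p U (insert a ⁻¹' A) :=
  subsetExp_insert ha _

end SubsetExp

lemma exists_card_eq_forall_le {r : ℕ} (u : Fin r → ℝ) {s : ℕ} (hs : s ≤ r) :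
    ∃ I : Finset (Fin r), #I = s ∧ ∀ i ∈ I, ∀ j ∉ I, u j ≤ u i := by
  induction s with
  | zero => exact ⟨∅, by simp⟩
  | succ s ih =>
    obtain ⟨I, hI, h⟩ := ih (by omega)
    have hne : (Iᶜ).Nonempty := by
      rw [← card_pos, card_compl, Fintype.card_fin]
      omega
    obtain ⟨b, hb, hmax⟩ := exists_max_image Iᶜ u hne
    rw [mem_compl] at hb
    refine ⟨insert b I, by rw [card_insert_of_notMem hb, hI], fun i hi j hj => ?_⟩
    rw [mem_insert, not_or] at hj
    rcases mem_insert.1 hi with rfl | hi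
    · exact hmax j (mem_compl.2 hj.2)
    · exact h i hi j hj.2

/-- The gain from paying `d - 1` is dominated by the average defect, when `I` holds the `s`
largest values of `u`. -/
lemma card_mul_sub_one_le_sum_one_sub {r s : ℕ} (hs : 1 ≤ s) (u : Fin r → ℝ)
    (hu0 : ∀ i, 0 ≤ u i) (hu1 : ∀ i, u i ≤ 1) (I : Finset (Fin r)) (hI : #I = s)
    (htop : ∀ i ∈ I, ∀ j ∉ I, u j ≤ u i) {d : ℝ} (hdr : d * s ≤ r)
    (hd : d * ∏ i ∈ I, u i ^ (1 / s : ℝ) ≤ 1) :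
    s * (d - 1) ≤ ∑ i, (1 - u i) := by
  have hs0 : (0 : ℝ) < s := by exact_mod_cast hs
  obtain ⟨b, hb, hmin⟩ := exists_min_image I u (card_pos.1 (by omega))
  have hsplit : ∑ i, (1 - u i) = ∑ i ∈ I, (1 - u i) + ∑ i ∈ Iᶜ, (1 - u i) :=
    (sum_add_sum_compl I _).symm
  have hcard : (#Iᶜ : ℝ) = r - s := by
    have h := card_add_card_compl I
    rw [hI, Fintype.card_fin] at h
    rw [eq_sub_iff_add_eq']
    exact_mod_cast h
  have hcompl : ((r : ℝ) - s) * (1 - u b) ≤ ∑ i ∈ Iᶜ, (1 - u i) := by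
    rw [← hcard, ← nsmul_eq_mul]
    exact card_nsmul_le_sum _ _ _ fun j hj => by linarith [htop b hb j (mem_compl.1 hj)]
  have hgap : s * (d - 1) * (1 - u b) ≤ ((r : ℝ) - s) * (1 - u b) :=
    mul_le_mul_of_nonneg_right (by linarith) (by linarith [hu1 b])
  suffices hI' : s * (d - 1) * u b ≤ ∑ i ∈ I, (1 - u i) by
    rw [hsplit]
    linarith
  rcases (hu0 b).eq_or_lt with h0 | hpos
  · rw [← h0, mul_zero]
    exact sum_nonneg fun i _ => by linarith [hu1 i]
  have hupos : ∀ i ∈ I, 0 < u i := fun i hi => hpos.trans_le (hmin i hi)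
  have hgm : d ≤ ∏ i ∈ I, (u i)⁻¹ ^ (1 / s : ℝ) := by
    have hP : 0 < ∏ i ∈ I, u i ^ (1 / s : ℝ) :=
      prod_pos fun i hi => Real.rpow_pos_of_pos (hupos i hi) _
    rw [prod_congr rfl fun i hi => Real.inv_rpow (hu0 i) _, prod_inv_distrib]
    rwa [← one_div, le_div_iff₀ hP]
  have ham : ∏ i ∈ I, (u i)⁻¹ ^ (1 / s : ℝ) ≤ ∑ i ∈ I, (1 / s : ℝ) * (u i)⁻¹ := by
    refine Real.geom_mean_le_arith_mean_weighted I (fun _ => (1 / s : ℝ)) _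
      (fun i _ => by positivity) ?_ fun i _ => inv_nonneg.2 (hu0 i)
    rw [sum_const, hI, nsmul_eq_mul]
    field_simp
  have hsum : s * d ≤ ∑ i ∈ I, (u i)⁻¹ := by
    have := hgm.trans ham
    rw [← mul_sum, one_div, inv_mul_eq_div, le_div_iff₀ hs0] at this
    linarith
  calc s * (d - 1) * u b ≤ (∑ i ∈ I, ((u i)⁻¹ - 1)) * u b := by
        refine mul_le_mul_of_nonneg_right ?_ hpos.le
        rw [sum_sub_distrib, sum_const, hI, nsmul_eq_mul]
        linarith
    _ = ∑ i ∈ I, ((u i)⁻¹ - 1) * u b := sum_mul _ _ _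
    _ ≤ ∑ i ∈ I, ((u i)⁻¹ - 1) * u i := by
        refine sum_le_sum fun i hi => mul_le_mul_of_nonneg_left (hmin i hi) ?_
        exact sub_nonneg.2 ((one_le_inv₀ (hupos i hi)).2 (hu1 i))
    _ = ∑ i ∈ I, (1 - u i) := by
        refine sum_congr rfl fun i hi => ?_
        rw [sub_mul, inv_mul_cancel₀ (hupos i hi).ne', one_mul]

/-- The numerical inequality that drives the induction on the number of coordinates. -/
lemma mix_mul_prod_rpow_le_one {r s : ℕ} (hs : 1 ≤ s) {a b : Fin r → ℝ}
    (hb : ∀ i, 0 ≤ b i) (hba : ∀ i, b i ≤ a i) (I : Finset (Fin r)) (hI : #I = s)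
    (htop : ∀ i ∈ I, ∀ j ∉ I, b j / a j ≤ b i / a i) {t : ℝ} (ht0 : 0 ≤ t) (ht1 : t ≤ 1)
    {e₀ e₁ : ℝ} (he : e₁ ≤ r / s * e₀)
    (h₀ : e₀ * ∏ i, a i ^ (1 / s : ℝ) ≤ 1)
    (h₁ : e₁ * ∏ i, (if i ∈ I then b i else a i) ^ (1 / s : ℝ) ≤ 1) :
    ((1 - t) * e₀ + t * e₁) * ∏ i, ((1 - t) * a i + t * b i) ^ (1 / s : ℝ) ≤ 1 := by
  have hs0 : (0 : ℝ) < s := by exact_mod_cast hs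
  have ha : ∀ i, 0 ≤ a i := fun i => (hb i).trans (hba i)
  by_cases hz : ∃ i, a i = 0
  · obtain ⟨i, hi⟩ := hz
    have hbi : b i = 0 := le_antisymm (hi ▸ hba i) (hb i)
    rw [prod_eq_zero (mem_univ i)
      (by rw [hi, hbi, mul_zero, mul_zero, add_zero, Real.zero_rpow (by positivity)]), mul_zero]
    exact zero_le_one
  push Not at hz
  have hapos : ∀ i, 0 < a i := fun i => (ha i).lt_of_ne' (hz i)
  set u : Fin r → ℝ := fun i => b i / a i with hu
  have hu0 : ∀ i, 0 ≤ u i := fun i => div_nonneg (hb i) (ha i)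
  have hu1 : ∀ i, u i ≤ 1 := fun i => div_le_one_of_le₀ (hba i) (ha i)
  have hbu : ∀ i, b i = a i * u i := fun i => (mul_div_cancel₀ _ (hz i)).symm
  set D := ∏ i, a i ^ (1 / s : ℝ) with hD
  have hDpos : 0 < D := prod_pos fun i _ => Real.rpow_pos_of_pos (hapos i) _
  have hI' : ∏ i, (if i ∈ I then b i else a i) ^ (1 / s : ℝ) =
      D * ∏ i ∈ I, u i ^ (1 / s : ℝ) := by
    rw [hD, ← Fintype.prod_ite_mem I, ← prod_mul_distrib]
    refine prod_congr rfl fun i _ => ?_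
    split_ifs
    · rw [hbu, Real.mul_rpow (ha i) (hu0 i)]
    · rw [mul_one]
  have hmix : ∏ i, ((1 - t) * a i + t * b i) ^ (1 / s : ℝ) =
      D * ∏ i, (1 - t * (1 - u i)) ^ (1 / s : ℝ) := by
    rw [hD, ← prod_mul_distrib]
    refine prod_congr rfl fun i _ => ?_
    rw [← Real.mul_rpow (ha i) (by nlinarith [hu0 i, hu1 i]), hbu]
    congr 1
    ring
  set d := e₁ * D with hd
  have hdα : d ≤ r / s := by
    calc e₁ * D ≤ r / s * e₀ * D := mul_le_mul_of_nonneg_right he hDpos.le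
      _ = r / s * (e₀ * D) := by ring
      _ ≤ r / s := mul_le_of_le_one_right (by positivity) h₀
  have hdP : d * ∏ i ∈ I, u i ^ (1 / s : ℝ) ≤ 1 := by
    rwa [hI', ← mul_assoc] at h₁
  have hkey := card_mul_sub_one_le_sum_one_sub hs u hu0 hu1 I hI htop
    ((le_div_iff₀ hs0).1 hdα) hdP
  set M := ∑ i, (1 - u i) with hM
  have hdM : d - 1 ≤ M / s := by
    rw [le_div_iff₀ hs0]
    linarith
  have hexp : ∏ i, (1 - t * (1 - u i)) ^ (1 / s : ℝ) ≤ Real.exp (-(t * (M / s))) := by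
    calc ∏ i, (1 - t * (1 - u i)) ^ (1 / s : ℝ)
        ≤ ∏ i, Real.exp (-(t * (1 - u i)) * (1 / s)) := by
          refine prod_le_prod (fun i _ => Real.rpow_nonneg (by nlinarith [hu0 i, hu1 i]) _)
            fun i _ => ?_
          rw [Real.exp_mul]
          refine Real.rpow_le_rpow (by nlinarith [hu0 i, hu1 i]) ?_ (by positivity)
          exact Real.one_sub_le_exp_neg _
      _ = Real.exp (-(t * (M / s))) := by
          rw [← Real.exp_sum, ← sum_mul, sum_neg_distrib, ← mul_sum]
          congr 1
          ring
  have hQ0 : 0 ≤ ∏ i, (1 - t * (1 - u i)) ^ (1 / s : ℝ) :=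
    prod_nonneg fun i _ => Real.rpow_nonneg (by nlinarith [hu0 i, hu1 i]) _
  have hlin : ((1 - t) * e₀ + t * e₁) * D ≤ Real.exp (t * (M / s)) := by
    have h1 : (1 - t) * (e₀ * D) ≤ (1 - t) * 1 :=
      mul_le_mul_of_nonneg_left h₀ (by linarith)
    have h2 : t * (d - 1) ≤ t * (M / s) := mul_le_mul_of_nonneg_left hdM ht0
    linarith [Real.add_one_le_exp (t * (M / s))]
  rw [hmix, ← mul_assoc]
  calc _ ≤ Real.exp (t * (M / s)) * Real.exp (-(t * (M / s))) :=
        mul_le_mul hlin hexp hQ0 (Real.exp_pos _).le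
    _ = 1 := by rw [← Real.exp_add, add_neg_cancel, Real.exp_zero]

section CoversUpTo

variable {ι : Type*} [DecidableEq ι] {r s : ℕ} {A : Fin r → Set (Finset ι)}

lemma CoversUpTo.insert_succ {x : Finset ι} {l : ℕ} (h : CoversUpTo s A x l) (a : ι) :
    CoversUpTo s A (insert a x) (l + 1) := by
  obtain ⟨y, hy, hl⟩ := h
  refine ⟨y, hy, ?_⟩
  rw [filter_insert]
  split_ifs
  · exact (card_insert_le _ _).trans (by omega)
  · omega

lemma CoversUpTo.insert_of_preimage {x : Finset ι} {l : ℕ} {a : ι} {I : Finset (Fin r)}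
    (hI : s ≤ #I)
    (h : CoversUpTo s (fun i => if i ∈ I then insert a ⁻¹' A i else A i) x l) :
    CoversUpTo s A (insert a x) l := by
  obtain ⟨y, hy, hl⟩ := h
  refine ⟨fun i => if i ∈ I then insert a (y i) else y i, fun i => ?_, ?_⟩
  · have := hy i
    dsimp only at this ⊢
    split_ifs at this ⊢ with hi
    · exact this
    · exact this
  refine (card_le_card fun j hj => ?_).trans hl
  rw [mem_filter, mem_insert] at hj
  have hmono : ∀ i, j ∈ y i → j ∈ (if i ∈ I then insert a (y i) else y i) := by
    intro i hji
    split_ifs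
    · exact mem_insert_of_mem hji
    · exact hji
  rw [mem_filter]
  refine ⟨hj.1.resolve_left ?_, (card_le_card fun i hi => ?_).trans_lt hj.2⟩
  · rintro rfl
    refine absurd hj.2 (not_lt.2 (hI.trans (card_le_card fun i hi => ?_)))
    simp [hi]
  · rw [mem_filter] at hi ⊢
    exact ⟨hi.1, hmono i hi.2⟩

end CoversUpTo

lemma subsetProb_of_empty_notMem {ι : Type*} [DecidableEq ι] (p : ι → ℝ) (U : Finset ι)
    {A : Set (Finset ι)} (hA : IsLowerSet A) (h : ∅ ∉ A) : subsetProb p U A = 0 := by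
  refine sum_eq_zero fun x _ => ?_
  rw [Set.indicator_of_notMem (fun hx => h (hA (empty_subset x) hx)), mul_zero]

/-- Talagrand's control of a random set by `r` points, each element being covered `s` times,
for lower sets. -/
theorem exists_coversUpTo_subsetExp_le {ι : Type*} [DecidableEq ι] {p : ι → ℝ}
    (hp : ∀ j, 0 ≤ p j ∧ p j ≤ 1) {r s : ℕ} (hs : 1 ≤ s) (hsr : s ≤ r) (U : Finset ι)
    (A : Fin r → Set (Finset ι)) (hA : ∀ i, IsLowerSet (A i)) (hne : ∀ i, ∅ ∈ A i) :
    ∃ N : Finset ι → ℕ, (∀ x ⊆ U, CoversUpTo s A x (N x)) ∧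
      subsetExp p U (fun x => ((r : ℝ) / s) ^ N x) * ∏ i, subsetProb p U (A i) ^ (1 / s : ℝ)
        ≤ 1 := by
  have hs0 : (0 : ℝ) < s := by exact_mod_cast hs
  induction U using Finset.induction_on generalizing A with
  | empty =>
    refine ⟨fun _ => 0, fun x hx => ⟨fun _ => ∅, hne, ?_⟩, ?_⟩
    · rw [subset_empty.1 hx]
      simp
    · simp [subsetExp, subsetProb, subsetWeight, hne]
  | insert a U ha ih =>
    set B : Fin r → Set (Finset ι) := fun i => insert a ⁻¹' A i with hB
    have hBl : ∀ i, IsLowerSet (B i) := fun i x y hxy hx => hA i (insert_subset_insert a hxy) hx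
    have hBA : ∀ i, B i ⊆ A i := fun i x hx => hA i (subset_insert a x) hx
    obtain ⟨I, hI, htop⟩ := exists_card_eq_forall_le
      (fun i => subsetProb p U (B i) / subsetProb p U (A i)) hsr
    set C : Fin r → Set (Finset ι) := fun i => if i ∈ I then B i else A i with hC
    have hCl : ∀ i, IsLowerSet (C i) := fun i => by
      simp only [hC]
      split_ifs
      exacts [hBl i, hA i]
    have hCP : ∀ i, subsetProb p U (C i) =
        if i ∈ I then subsetProb p U (B i) else subsetProb p U (A i) := fun i => by
      simp only [hC]
      split_ifs <;> rfl
    obtain ⟨N₀, hN₀, hE₀⟩ := ih A hA hne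
    obtain ⟨N₁, hN₁, hE, hE₁⟩ : ∃ N₁ : Finset ι → ℕ,
        (∀ x ⊆ U, CoversUpTo s A (insert a x) (N₁ x)) ∧
        subsetExp p U (fun x => ((r : ℝ) / s) ^ N₁ x) ≤
          r / s * subsetExp p U (fun x => ((r : ℝ) / s) ^ N₀ x) ∧
        subsetExp p U (fun x => ((r : ℝ) / s) ^ N₁ x) *
          ∏ i, subsetProb p U (C i) ^ (1 / s : ℝ) ≤ 1 := by
      have hsucc : subsetExp p U (fun x => ((r : ℝ) / s) ^ (N₀ x + 1)) =
          r / s * subsetExp p U (fun x => ((r : ℝ) / s) ^ N₀ x) := by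
        rw [← subsetExp_const_mul]
        simp only [pow_succ']
      by_cases hCne : ∀ i, ∅ ∈ C i
      · obtain ⟨N, hN, hNE⟩ := ih C hCl hCne
        rcases le_total (subsetExp p U (fun x => ((r : ℝ) / s) ^ N x))
          (r / s * subsetExp p U (fun x => ((r : ℝ) / s) ^ N₀ x)) with hle | hle
        · exact ⟨N, fun x hx => (hN x hx).insert_of_preimage hI.ge, hle, hNE⟩
        · refine ⟨fun x => N₀ x + 1, fun x hx => (hN₀ x hx).insert_succ a, hsucc.le, ?_⟩
          rw [hsucc]
          exact (mul_le_mul_of_nonneg_right hle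
            (prod_nonneg fun i _ => Real.rpow_nonneg (subsetProb_nonneg hp _ _) _)).trans hNE
      · push Not at hCne
        obtain ⟨i, hi⟩ := hCne
        refine ⟨fun x => N₀ x + 1, fun x hx => (hN₀ x hx).insert_succ a, hsucc.le, ?_⟩
        rw [prod_eq_zero (mem_univ i) (by
          rw [subsetProb_of_empty_notMem p U (hCl i) hi, Real.zero_rpow (by positivity)]),
          mul_zero]
        exact zero_le_one
    refine ⟨fun x => if a ∈ x then N₁ (x.erase a) else N₀ x, fun x hx => ?_, ?_⟩
    · dsimp only
      split_ifs with hax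
      · have := hN₁ (x.erase a) (subset_insert_iff.1 hx)
        rwa [insert_erase hax] at this
      · exact hN₀ x ((subset_insert_iff_of_notMem hax).1 hx)
    · rw [subsetExp_insert ha,
        subsetExp_congr (G := fun x => ((r : ℝ) / s) ^ N₀ x) fun x hx => by
          simp only [if_neg fun h => ha (hx h)],
        subsetExp_congr
          (F := fun x => ((r : ℝ) / s) ^
            if a ∈ insert a x then N₁ ((insert a x).erase a) else N₀ (insert a x))
          (G := fun x => ((r : ℝ) / s) ^ N₁ x) fun x hx => by
          simp only [if_pos (mem_insert_self a x), erase_insert fun h => ha (hx h)]]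
      simp only [subsetProb_insert ha]
      simp only [hCP] at hE₁
      exact mix_mul_prod_rpow_le_one hs (fun i => subsetProb_nonneg hp U (B i))
        (fun i => subsetProb_mono hp U (hBA i)) I hI htop (hp a).1 (hp a).2 hE hE₀ hE₁

lemma IsLipschitzVal.le_add_card {m : ℕ} {v : Finset (Fin m) → ℝ} (hLip : IsLipschitzVal m v)
    (G J : Finset (Fin m)) : v (J ∪ G) ≤ v G + #J := by
  induction J using Finset.induction_on with
  | empty => simp
  | insert j J hj ih =>
    rw [insert_union, card_insert_of_notMem hj]
    push_cast
    linarith [hLip (J ∪ G) j]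

lemma IsQPartitioning.le_of_cover {m q : ℕ} {v : Finset (Fin m) → ℝ} (hv : IsValuation m v)
    (hQ : IsQPartitioning m q v) {r s : ℕ} (hs : 1 ≤ s) (hr : 2 ^ r ≤ q)
    (y : Fin r → Finset (Fin m)) (G : Finset (Fin m))
    (hG : ∀ j ∈ G, s ≤ #{i | j ∈ y i}) :
    v G ≤ ∑ i, (1 / s : ℝ) * v (y i) := by
  have hs0 : (0 : ℝ) < s := by exact_mod_cast hs
  obtain ⟨e⟩ : Nonempty (Finset (Fin r) ↪ Fin q) :=
    Function.Embedding.nonempty_of_card_le (by simpa using hr)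
  set c : Fin m → Fin q := fun j => e {i | j ∈ y i} with hc
  set P : Fin q → Finset (Fin m) := fun k => {j ∈ G | c j = k} with hP
  set T : Fin r → Finset (Fin q) := fun i => image c {j ∈ G | j ∈ y i} with hT
  set Z : Finset (Fin q) := (image c G)ᶜ with hZ
  have hpart : IsPartitionInto m q G P := by
    refine ⟨fun i j hij => disjoint_left.2 fun x hx hx' => hij ?_, ?_⟩
    · rw [mem_filter] at hx hx'
      exact hx.2.symm.trans hx'.2
    · ext j
      simp [hP]
  have hTP : ∀ i, (T i).biUnion P ⊆ y i := by
    intro i j hj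
    obtain ⟨k, hk, hjk⟩ := mem_biUnion.1 hj
    obtain ⟨j', hj', rfl⟩ := mem_image.1 hk
    have hpat := e.injective (mem_filter.1 hjk).2
    have : i ∈ ({i | j' ∈ y i} : Finset (Fin r)) := by simpa using (mem_filter.1 hj').2
    rw [← hpat] at this
    simpa using this
  have hZP : Z.biUnion P = ∅ := by
    refine eq_empty_of_forall_notMem fun j hj => ?_
    obtain ⟨k, hk, hjk⟩ := mem_biUnion.1 hj
    obtain ⟨hjG, rfl⟩ := mem_filter.1 hjk
    exact mem_compl.1 hk (mem_image_of_mem c hjG)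
  set α : Finset (Fin q) → ℝ := fun R =>
    ∑ i, (if R = T i then (1 / s : ℝ) else 0) + if R = Z then 1 else 0 with hα
  have hsum : ∀ F : Finset (Fin q) → ℝ,
      ∑ R, α R * F R = ∑ i, (1 / s : ℝ) * F (T i) + F Z := by
    intro F
    simp only [hα, add_mul, sum_add_distrib, sum_mul, ite_mul, zero_mul, one_mul]
    rw [sum_comm]
    simp
  have hcover : IsFractionalCover q α := by
    refine ⟨fun R => by simp only [hα]; positivity, fun k => ?_⟩
    have : ∑ R with k ∈ R, α R = ∑ R, α R * (if k ∈ R then 1 else 0) := by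
      rw [sum_filter]
      exact sum_congr rfl fun R _ => by split_ifs <;> simp
    rw [this, hsum]
    by_cases hk : k ∈ image c G
    · obtain ⟨j, hj, rfl⟩ := mem_image.1 hk
      have hcount : (s : ℝ) ≤ ∑ i, if c j ∈ T i then (1 : ℝ) else 0 := by
        rw [sum_boole]
        refine Nat.cast_le.2 ((hG j hj).trans (card_le_card fun i hi => ?_))
        rw [mem_filter] at hi ⊢
        exact ⟨hi.1, mem_image_of_mem c (mem_filter.2 ⟨hj, hi.2⟩)⟩
      rw [← mul_sum]
      have h1 : (1 : ℝ) ≤ 1 / s * ∑ i, if c j ∈ T i then (1 : ℝ) else 0 := by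
        rw [one_div, inv_mul_eq_div, le_div_iff₀ hs0, one_mul]
        exact hcount
      have h2 : (0 : ℝ) ≤ if c j ∈ Z then 1 else 0 := by positivity
      linarith
    · rw [if_pos (mem_compl.2 hk)]
      have : (0 : ℝ) ≤ ∑ i, (1 / s : ℝ) * (if k ∈ T i then 1 else 0) := by positivity
      linarith
  have h := hQ G P hpart α hcover
  rw [hsum fun R => v (R.biUnion P), hZP, hv.1, add_zero] at h
  exact h.trans (sum_le_sum fun i _ =>
    mul_le_mul_of_nonneg_left (hv.2.1 _ _ (hTP i)) (by positivity))

lemma CoversUpTo.val_le {m q : ℕ} {v : Finset (Fin m) → ℝ} (hv : IsValuation m v)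
    (hQ : IsQPartitioning m q v) (hLip : IsLipschitzVal m v) {r s : ℕ} (hs : 1 ≤ s)
    (hr : 2 ^ r ≤ q) {a : ℝ} {x : Finset (Fin m)} {l : ℕ}
    (h : CoversUpTo (r := r) s (fun _ => {S | v S ≤ a}) x l) : v x ≤ r / s * a + l := by
  obtain ⟨y, hy, hl⟩ := h
  set J : Finset (Fin m) := {j ∈ x | #{i | j ∈ y i} < s} with hJ
  have hG := hQ.le_of_cover hv hs hr y (x \ J) fun j hj => by
    rw [mem_sdiff, hJ, mem_filter] at hj
    by_contra hlt
    exact hj.2 ⟨hj.1, not_le.1 hlt⟩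
  have hsum : ∑ i, (1 / s : ℝ) * v (y i) ≤ r / s * a := by
    calc ∑ i, (1 / s : ℝ) * v (y i) ≤ ∑ _i : Fin r, (1 / s : ℝ) * a :=
          sum_le_sum fun i _ => mul_le_mul_of_nonneg_left (hy i) (by positivity)
      _ = r / s * a := by
          rw [sum_const, card_univ, Fintype.card_fin, nsmul_eq_mul]
          ring
  have hx := hLip.le_add_card (x \ J) J
  rw [union_sdiff_of_subset (filter_subset _ x)] at hx
  have : (#J : ℝ) ≤ l := by exact_mod_cast hl
  linarith

lemma sum_filter_prodWeight {m : ℕ} (p : Fin m → ℝ) (Q : Finset (Fin m) → Prop) :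
    ∑ S with Q S, prodWeight m p S = subsetProb p univ {S | Q S} := by
  rw [subsetProb, subsetExp, powerset_univ, sum_filter]
  refine sum_congr rfl fun S _ => ?_
  rw [prodWeight, subsetWeight, compl_eq_univ_sdiff, Set.indicator_apply]
  simp only [Set.mem_ofPred_eq, Pi.one_apply, mul_ite, mul_one, mul_zero]

theorem qPartitioning_upperTail (m q : ℕ) (hq : 2 ≤ q) (hqm : q ≤ m)
    (v : Finset (Fin m) → ℝ) (hv : IsValuation m v)
    (hQ : IsQPartitioning m q v) (hLip : IsLipschitzVal m v)
    (p : Fin m → ℝ) (hp : ∀ j, 0 ≤ p j ∧ p j ≤ 1)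
    (a k : ℝ) (ha : 0 ≤ a) (hk : 0 ≤ k)
    (hmed : (1 / 2 : ℝ) ≤
      ∑ S ∈ Finset.univ.filter (fun S : Finset (Fin m) => v S ≤ a), prodWeight m p S)
    (s r : ℕ) (hs : 1 ≤ s) (hsr : s < r) (hr : 2 ^ r ≤ q) :
    ∑ S ∈ Finset.univ.filter
        (fun S : Finset (Fin m) => ((r : ℝ) / s) * a + k ≤ v S), prodWeight m p S ≤
      ((r : ℝ) / s) ^ (-k) * (2 : ℝ) ^ ((r : ℝ) / s) := by
  have hs0 : (0 : ℝ) < s := by exact_mod_cast hs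
  have hα : (1 : ℝ) < r / s := by
    rw [lt_div_iff₀ hs0, one_mul]
    exact_mod_cast hsr
  have hα0 : (0 : ℝ) < r / s := one_pos.trans hα
  rw [sum_filter_prodWeight] at hmed ⊢
  set π := subsetProb p univ {S : Finset (Fin m) | v S ≤ a} with hπ
  obtain ⟨N, hN, hE⟩ := exists_coversUpTo_subsetExp_le hp hs hsr.le univ
    (fun _ : Fin r => {S : Finset (Fin m) | v S ≤ a})
    (fun _ S T hTS hS => (hv.2.1 T S hTS).trans hS) fun _ => hv.1.le.trans ha
  set E := subsetExp p univ fun x => ((r : ℝ) / s) ^ N x with hEdef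
  have hE0 : 0 ≤ E := subsetExp_nonneg hp _ fun x => by positivity
  have hpow : ∏ _i : Fin r, π ^ (1 / s : ℝ) = π ^ (r / s : ℝ) := by
    rw [prod_const, card_univ, Fintype.card_fin, ← Real.rpow_mul_natCast (by linarith)]
    congr 1
    ring
  rw [← hπ, hpow] at hE
  have hEle : E ≤ 2 ^ (r / s : ℝ) := by
    have h1 : (1 / 2 : ℝ) ^ (r / s : ℝ) ≤ π ^ (r / s : ℝ) :=
      Real.rpow_le_rpow (by norm_num) hmed hα0.le
    have h2 := (mul_le_mul_of_nonneg_left h1 hE0).trans hE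
    rwa [one_div, Real.inv_rpow zero_le_two, ← div_eq_mul_inv,
      div_le_one (by positivity)] at h2
  calc subsetProb p univ {S | (r : ℝ) / s * a + k ≤ v S}
      ≤ subsetExp p univ fun x => ((r : ℝ) / s) ^ (-k) * ((r : ℝ) / s) ^ N x := by
        refine subsetExp_mono hp _ fun x => Set.indicator_apply_le' (fun hx => ?_)
          fun _ => by positivity
        have hval := (hN x (subset_univ x)).val_le hv hQ hLip hs hr
        have hkN : k ≤ N x := by linarith [show r / s * a + k ≤ v x from hx]
        rw [← Real.rpow_natCast, ← Real.rpow_add hα0]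
        exact Real.one_le_rpow hα.le (by linarith)
    _ = ((r : ℝ) / s) ^ (-k) * E := subsetExp_const_mul _ _ _
    _ ≤ _ := mul_le_mul_of_nonneg_left hEle (by positivity)
end
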